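/- arXiv:math/0309355 — 12 statements merged into one kernel-verified Lean document; each statement's English description precedes it below -/
import Mathlib

section
/- Under AB, (σ³/μ)·(κ/μ − 2(λ² − 1/4)/μ²) → 1. -/
open Filter

noncomputable def np (m : ℕ) : ℝ := m + 1/2

noncomputable def mu (n N : ℕ) : ℝ := (Real.sqrt (np n) + Real.sqrt (np N)) ^ 2

noncomputable def sig (n N : ℕ) : ℝ :=
  (Real.sqrt (np n) + Real.sqrt (np N)) *
    (1 / Real.sqrt (np n) + 1 / Real.sqrt (np N)) ^ ((1 : ℝ) / 3)

noncomputable def kap (n N : ℕ) : ℝ := ((n : ℝ) + N + 1) / 2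

noncomputable def lam (n N : ℕ) : ℝ := ((n : ℝ) - N) / 2

lemma key_identity (m N : ℕ) :
    (sig m N ^ 3 / mu m N) *
          (kap m N / mu m N - 2 * (lam m N ^ 2 - 1/4) / (mu m N) ^ 2)
      = 1 + 1 / (2 * (Real.sqrt (np m) * Real.sqrt (np N)) * mu m N) := by
  have hm : 0 < np m := by unfold np; positivity
  have hN : 0 < np N := by unfold np; positivity
  have hk : kap m N = (np m + np N) / 2 := by unfold kap np; ring
  have hl : lam m N = (np m - np N) / 2 := by unfold lam np; ring
  have ha := Real.sqrt_pos.2 hm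
  have hb := Real.sqrt_pos.2 hN
  have ea := Real.sq_sqrt hm.le
  have eb := Real.sq_sqrt hN.le
  rw [hk, hl]
  unfold sig mu
  generalize Real.sqrt (np m) = a at *
  generalize Real.sqrt (np N) = b at *
  rw [← ea, ← eb, mul_pow, ← Real.rpow_natCast ((1 / a + 1 / b) ^ ((1 : ℝ) / 3)) 3,
    ← Real.rpow_mul (by positivity)]
  norm_num
  have : a + b ≠ 0 := by positivity
  field_simp
  ring

/-- Under AB, `(σ³/μ)·(κ/μ − 2(λ² − 1/4)/μ²) → 1`. -/
theorem sigma_cubed_coefficient_limit (n : ℕ → ℕ) (hn : ∀ N, N < n N)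
    (hAB : Tendsto (fun N : ℕ => (n N : ℝ) / N) atTop atTop) :
    Tendsto (fun N : ℕ =>
        (sig (n N) N ^ 3 / mu (n N) N) *
          (kap (n N) N / mu (n N) N - 2 * (lam (n N) N ^ 2 - 1/4) / (mu (n N) N) ^ 2))
      atTop (nhds 1) := by
  simp_rw [key_identity]
  have h0 : Tendsto (fun N : ℕ =>
      1 / (2 * (Real.sqrt (np (n N)) * Real.sqrt (np N)) * mu (n N) N)) atTop (nhds 0) := by
    refine squeeze_zero (fun N => ?_) (fun N => ?_) tendsto_one_div_add_atTop_nhds_zero_nat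
    · unfold mu; positivity
    · have hN : 0 < np N := by unfold np; positivity
      have hle : np N ≤ np (n N) := by
        have : (N : ℝ) ≤ n N := by exact_mod_cast (hn N).le
        unfold np; linarith
      have hb := Real.sqrt_pos.2 hN
      have hab := Real.sqrt_le_sqrt hle
      have eb := Real.sq_sqrt hN.le
      have h1 : np N ≤ Real.sqrt (np (n N)) * Real.sqrt (np N) := by nlinarith
      have h2 : 4 * np N ≤ mu (n N) N := by unfold mu; nlinarith
      have h3 : np N * (4 * np N) ≤ Real.sqrt (np (n N)) * Real.sqrt (np N) * mu (n N) N :=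
        mul_le_mul h1 h2 (by positivity) (by positivity)
      have h4 : np N = N + 1 / 2 := rfl
      have h5 : (0 : ℝ) ≤ N := by positivity
      apply one_div_le_one_div_of_le (by positivity)
      have h6 : (N : ℝ) + 1 ≤ 2 * (np N * (4 * np N)) := by rw [h4]; nlinarith
      linarith
  simpa using h0.const_add 1
end

section
/- For every fixed real number s, under AB one has σ²·( 1/4 − κ/(μ + σs) + (λ² − 1/4)/(μ + σs)² ) → s. (This identifies the limiting coefficient in the Laguerre/Whittaker differential equation after the rescaling z = μ + σs, and is the key step showing the second derivative of the rescaled Laguerre function converges to the Airy coefficient s.) -/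
open Filter

theorem airy_alg (a b c s t : ℝ) (ha : 0 < a) (hb : 0 < b)
    (hc : c ^ 3 = 1 / a + 1 / b) (ht : t = c / (a + b)) (hu : 1 + t * s ≠ 0) :
    ((a + b) * c) ^ 2 * (1/4 - ((a^2 + b^2) / 2) / ((a + b)^2 + (a + b) * c * s)
      + (((a^2 - b^2) / 2)^2 - 1/4) / ((a + b)^2 + (a + b) * c * s) ^ 2)
    = (4 * s + c ^ 4 * s ^ 2 - t ^ 2) / (4 * (1 + t * s) ^ 2) := by
  have hM : a + b ≠ 0 := by positivity
  have hct : c = t * (a + b) := by rw [ht]; field_simp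
  have hc3 : c ^ 3 * (a * b) = a + b := by rw [hc]; field_simp; ring
  have hz : (a + b)^2 + (a + b) * c * s = (a + b)^2 * (1 + t * s) := by rw [hct]; ring
  have hz0 : (a + b)^2 + (a + b) * c * s ≠ 0 := by
    rw [hz]; exact mul_ne_zero (pow_ne_zero _ hM) hu
  have h1 : 1 / 4 - ((a^2 + b^2) / 2) / ((a + b)^2 + (a + b) * c * s)
      + (((a^2 - b^2) / 2)^2 - 1/4) / ((a + b)^2 + (a + b) * c * s) ^ 2
      = ((a + b) * c * s * (4 * (a * b) + (a + b) * c * s) - 1)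
        / (4 * ((a + b)^2 + (a + b) * c * s) ^ 2) := by
    generalize hZ : (a + b)^2 + (a + b) * c * s = z at *
    have : (a + b) * c * s = z - (a + b)^2 := by rw [← hZ]; ring
    rw [this]
    field_simp
    ring
  rw [h1, hz, ← mul_div_assoc, div_eq_div_iff (by positivity) (by positivity)]
  have key : ((a + b) * c) ^ 2 * ((a + b) * c * s * (4 * (a * b) + (a + b) * c * s) - 1)
      = (a + b) ^ 4 * (4 * s + c ^ 4 * s ^ 2 - t ^ 2) := by
    have h2 : (a + b) ^ 4 * t ^ 2 = (a + b) ^ 2 * c ^ 2 := by rw [hct]; ring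
    linear_combination 4 * s * (a + b) ^ 3 * hc3 + h2
  rw [key]; ring

/-- For every fixed real `s`, under AB,
`σ²·(1/4 − κ/(μ + σs) + (λ² − 1/4)/(μ + σs)²) → s`. -/
theorem airy_coefficient_limit (s : ℝ) (n : ℕ → ℕ) (hn : ∀ N, N < n N)
    (hAB : Tendsto (fun N : ℕ => (n N : ℝ) / N) atTop atTop) :
    Tendsto (fun N : ℕ =>
        sig (n N) N ^ 2 *
          (1/4 - kap (n N) N / (mu (n N) N + sig (n N) N * s)
            + (lam (n N) N ^ 2 - 1/4) / (mu (n N) N + sig (n N) N * s) ^ 2))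
      atTop (nhds s) := by
  set b : ℕ → ℝ := fun N => Real.sqrt (np N) with hb
  set a : ℕ → ℝ := fun N => Real.sqrt (np (n N)) with ha
  have hnp : ∀ m, 0 < np m := fun m => by unfold np; positivity
  have hbpos : ∀ N, 0 < b N := fun N => Real.sqrt_pos.2 (hnp _)
  have hapos : ∀ N, 0 < a N := fun N => Real.sqrt_pos.2 (hnp _)
  have hbt : Tendsto b atTop atTop := by
    refine Real.tendsto_sqrt_atTop.comp ?_
    exact tendsto_atTop_add_const_right _ _ tendsto_natCast_atTop_atTop
  have hat : Tendsto a atTop atTop := by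
    refine tendsto_atTop_mono (fun N => ?_) hbt
    refine Real.sqrt_le_sqrt ?_
    have : (N : ℝ) ≤ n N := by exact_mod_cast (hn N).le
    unfold np; linarith
  set c : ℕ → ℝ := fun N => (1 / a N + 1 / b N) ^ ((1 : ℝ) / 3) with hc
  have hct : Tendsto c atTop (nhds 0) := by
    have h : Tendsto (fun N => 1 / a N + 1 / b N) atTop (nhds 0) := by
      simpa using hat.inv_tendsto_atTop.add hbt.inv_tendsto_atTop
    have := h.rpow_const (p := (1 : ℝ) / 3) (Or.inr (by norm_num))
    rwa [Real.zero_rpow (by norm_num)] at this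
  have htt : Tendsto (fun N => c N / (a N + b N)) atTop (nhds 0) :=
    hct.div_atTop (hat.atTop_add_atTop hbt)
  have hut : Tendsto (fun N => 1 + c N / (a N + b N) * s) atTop (nhds 1) := by
    simpa using (htt.mul_const s).const_add 1
  have hlim : Tendsto (fun N => (4 * s + c N ^ 4 * s ^ 2 - (c N / (a N + b N)) ^ 2)
      / (4 * (1 + c N / (a N + b N) * s) ^ 2)) atTop (nhds s) := by
    have := ((((hct.pow 4).mul_const (s ^ 2)).const_add (4 * s)).sub (htt.pow 2)).div
      ((hut.pow 2).const_mul 4) (by norm_num)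
    convert this using 2
    all_goals norm_num
  refine hlim.congr' ?_
  filter_upwards [hut.eventually_ne one_ne_zero] with N hN
  have hc3 : c N ^ 3 = 1 / a N + 1 / b N := by
    have : 0 ≤ 1 / a N + 1 / b N := by have := hapos N; have := hbpos N; positivity
    simp only [hc]
    rw [← Real.rpow_natCast, ← Real.rpow_mul this]; norm_num
  rw [← airy_alg (a N) (b N) (c N) s _ (hapos N) (hbpos N) hc3 rfl hN]
  have ea : a N ^ 2 = n N + 1 / 2 := Real.sq_sqrt (hnp _).le
  have eb : b N ^ 2 = N + 1 / 2 := Real.sq_sqrt (hnp _).le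
  have hk : kap (n N) N = (a N ^ 2 + b N ^ 2) / 2 := by rw [ea, eb]; unfold kap; ring
  have hl : lam (n N) N = (a N ^ 2 - b N ^ 2) / 2 := by rw [ea, eb]; unfold lam; ring
  rw [hk, hl]
  rfl
end

section
/- Under AB, writing μ = μ_{n,N}, σ = σ_{n,N} (parameters (n,N)) and μ' = μ_{n−1,N−1}, σ' = σ_{n−1,N−1} (parameters (n−1, N−1)), there exists N₀ such that for all N ≥ N₀ and all s ≥ 0: (μ − μ')/σ' + (σ/σ')·s ≥ s/2. (That is, the variable s' defined by μ + σs = μ' + σ's' satisfies s' ≥ s/2 on [0, ∞) for N large enough.) -/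
open Filter

/-- `μ_{n−1,N−1} = (√(n−1/2) + √(N−1/2))²`. -/
noncomputable def mu' (n N : ℕ) : ℝ :=
  (Real.sqrt ((n : ℝ) - 1/2) + Real.sqrt ((N : ℝ) - 1/2)) ^ 2

/-- `σ_{n−1,N−1} = (√(n−1/2) + √(N−1/2))·(1/√(n−1/2) + 1/√(N−1/2))^{1/3}`. -/
noncomputable def sig' (n N : ℕ) : ℝ :=
  (Real.sqrt ((n : ℝ) - 1/2) + Real.sqrt ((N : ℝ) - 1/2)) *
    (1 / Real.sqrt ((n : ℝ) - 1/2) + 1 / Real.sqrt ((N : ℝ) - 1/2)) ^ ((1 : ℝ) / 3)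

theorem sqrt_aux (m : ℕ) (h : (1 : ℝ) ≤ m) :
    0 < Real.sqrt ((m : ℝ) - 1/2) ∧ Real.sqrt ((m : ℝ) - 1/2) ≤ Real.sqrt ((m : ℝ) + 1/2) ∧
      Real.sqrt ((m : ℝ) + 1/2) ≤ 2 * Real.sqrt ((m : ℝ) - 1/2) := by
  refine ⟨Real.sqrt_pos.2 (by linarith), Real.sqrt_le_sqrt (by linarith), ?_⟩
  rw [Real.sqrt_le_left (by positivity), mul_pow, Real.sq_sqrt (by linarith)]
  linarith

/-- Under AB, for `N` large, the variable `s'` defined by `μ + σs = μ' + σ's'`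
satisfies `s' = (μ − μ')/σ' + (σ/σ')·s ≥ s/2` for all `s ≥ 0`. -/
theorem shifted_variable_lower_bound (n : ℕ → ℕ) (hn : ∀ N, N + 1 < n N)
    (hAB : Tendsto (fun N : ℕ => (n N : ℝ) / N) atTop atTop) :
    ∃ N₀ : ℕ, ∀ N ≥ N₀, ∀ s : ℝ, 0 ≤ s →
      (mu (n N) N - mu' (n N) N) / sig' (n N) N + (sig (n N) N / sig' (n N) N) * s
        ≥ s / 2 := by
  refine ⟨1, fun N hN s hs => ?_⟩
  have h1 : (1 : ℝ) ≤ N := by exact_mod_cast hN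
  have h2 : (1 : ℝ) ≤ n N := by
    have := hn N
    exact_mod_cast (by omega : 1 ≤ n N)
  obtain ⟨a1, a2, a3⟩ := sqrt_aux (n N) h2
  obtain ⟨b1, b2, b3⟩ := sqrt_aux N h1
  unfold mu mu' sig sig' np
  generalize Real.sqrt ((n N : ℝ) + 1/2) = a at *
  generalize Real.sqrt ((n N : ℝ) - 1/2) = a' at *
  generalize Real.sqrt ((N : ℝ) + 1/2) = b at *
  generalize Real.sqrt ((N : ℝ) - 1/2) = b' at *
  have ha : 0 < a := by linarith
  have hb : 0 < b := by linarith
  have hc' : 0 < 1 / a' + 1 / b' := by positivity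
  have e1 : 1 / a' / 8 ≤ 1 / a := by
    rw [div_div]
    exact one_div_le_one_div_of_le ha (by linarith)
  have e2 : 1 / b' / 8 ≤ 1 / b := by
    rw [div_div]
    exact one_div_le_one_div_of_le hb (by linarith)
  have e3 : (1 / a' + 1 / b') ^ ((1 : ℝ) / 3) / 2 ≤ (1 / a + 1 / b) ^ ((1 : ℝ) / 3) := by
    have h8 : (8 : ℝ) ^ ((1 : ℝ) / 3) = 2 := by
      rw [show (8 : ℝ) = 2 ^ (3 : ℝ) by norm_num, ← Real.rpow_mul (by norm_num)]
      norm_num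
    calc _ = ((1 / a' + 1 / b') / 8) ^ ((1 : ℝ) / 3) := by
          rw [Real.div_rpow hc'.le (by norm_num), h8]
      _ ≤ _ := Real.rpow_le_rpow (by positivity) (by linarith) (by norm_num)
  have hp : 0 < (1 / a' + 1 / b') ^ ((1 : ℝ) / 3) := Real.rpow_pos_of_pos hc' _
  generalize (1 / a' + 1 / b') ^ ((1 : ℝ) / 3) = p at *
  generalize (1 / a + 1 / b) ^ ((1 : ℝ) / 3) = q at *
  have hs' : 0 < (a' + b') * p := by positivity
  have k1 : 0 ≤ ((a + b) ^ 2 - (a' + b') ^ 2) / ((a' + b') * p) := by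
    apply div_nonneg _ hs'.le
    nlinarith
  have k2 : 1 / 2 ≤ (a + b) * q / ((a' + b') * p) := by
    rw [le_div_iff₀ hs']
    have : (a' + b') * (p / 2) ≤ (a + b) * q :=
      mul_le_mul (by linarith) e3 (by positivity) (by positivity)
    linarith
  have := mul_le_mul_of_nonneg_right k2 hs
  linarith
end

section
/- Let 0 < x₁ < x₂ be real numbers and let x̄ = (x₁ + x₂)/2. Then ∫_{x₁}^{x̄} √((t − x₁)(x₂ − t))/(2t) dt ≥ ∫_{x̄}^{x₂} √((t − x₁)(x₂ − t))/(2t) dt. (This is the symmetry argument of Appendix A2 showing that the point where the auxiliary variable υ vanishes lies at or before the midpoint of the two turning points.) -/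
/-- For `0 < x₁ < x₂` and `x̄ = (x₁ + x₂)/2`,
`∫_{x₁}^{x̄} √((t − x₁)(x₂ − t))/(2t) dt ≥ ∫_{x̄}^{x₂} √((t − x₁)(x₂ − t))/(2t) dt`. -/
theorem midpoint_integral_comparison (x₁ x₂ : ℝ) (h1 : 0 < x₁) (h12 : x₁ < x₂) :
    (∫ t in ((x₁ + x₂) / 2)..x₂, Real.sqrt ((t - x₁) * (x₂ - t)) / (2 * t))
      ≤ ∫ t in x₁..((x₁ + x₂) / 2), Real.sqrt ((t - x₁) * (x₂ - t)) / (2 * t) := by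
  have key := intervalIntegral.integral_comp_sub_left (a := x₁) (b := (x₁ + x₂) / 2)
    (fun t => Real.sqrt ((t - x₁) * (x₂ - t)) / (2 * t)) (x₁ + x₂)
  have e1 : x₁ + x₂ - (x₁ + x₂) / 2 = (x₁ + x₂) / 2 := by ring
  have e2 : x₁ + x₂ - x₁ = x₂ := by ring
  rw [e1, e2] at key
  rw [← key]
  have hle : x₁ ≤ (x₁ + x₂) / 2 := by linarith
  apply intervalIntegral.integral_mono_on hle
  · apply ContinuousOn.intervalIntegrable
    rw [Set.uIcc_of_le hle]
    apply ContinuousOn.div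
    · fun_prop
    · fun_prop
    · intro t ht
      have := ht.2
      have : 0 < 2 * (x₁ + x₂ - t) := by linarith
      exact this.ne'
  · apply ContinuousOn.intervalIntegrable
    rw [Set.uIcc_of_le hle]
    apply ContinuousOn.div
    · fun_prop
    · fun_prop
    · intro t ht
      have := ht.1
      have : 0 < 2 * t := by linarith
      exact this.ne'
  · intro t ht
    have ha := ht.1
    have hb := ht.2
    have e : (x₁ + x₂ - t - x₁) * (x₂ - (x₁ + x₂ - t)) = (t - x₁) * (x₂ - t) := by ring
    rw [e]
    apply div_le_div_of_nonneg_left (Real.sqrt_nonneg _)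
    · linarith
    · linarith
end

section
/- For all real numbers 0 < a < b, under AB one has sup_{s ∈ [a,b]} | λ·( x(s)² − 4l·x(s) + 4 ) / (4·s·β·σ) − 1 | → 0, where x(s) = x₂ + sσ/λ. (That is, uniformly on compact subsets of (0, ∞), x² − 4lx + 4 = 4sβσλ^{−1}(1 + o(1)).) -/
open Filter

noncomputable def ell (n N : ℕ) : ℝ := kap n N / lam n N

noncomputable def beta (n N : ℕ) : ℝ := Real.sqrt (2 * (ell n N - 1))

noncomputable def x2 (n N : ℕ) : ℝ := 2 * ell n N + 2 * Real.sqrt (ell n N ^ 2 - 1)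

theorem aux_identity (l L s S r B : ℝ) (hL : 0 < L) (hs : 0 < s) (hS : 0 < S) (hB : 0 < B)
    (hr : r ^ 2 = l ^ 2 - 1) :
    L * ((2 * l + 2 * r + s * S / L) ^ 2 - 4 * l * (2 * l + 2 * r + s * S / L) + 4) /
      (4 * s * B * S) = r / B + s * (S / (4 * (B * L))) := by
  have h : (2 * l + 2 * r + s * S / L) ^ 2 - 4 * l * (2 * l + 2 * r + s * S / L) + 4
      = 4 * r * (s * S / L) + (s * S / L) ^ 2 := by
    linear_combination 4 * hr
  rw [h]
  field_simp

theorem aux_bound (n N : ℕ) (hN : 4 ≤ N) (h : 3 * N ≤ n) (s : ℝ) (hs : 0 < s) :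
    |lam n N * ((x2 n N + s * sig n N / lam n N) ^ 2
            - 4 * ell n N * (x2 n N + s * sig n N / lam n N) + 4) /
          (4 * s * beta n N * sig n N) - 1| ≤ 3 * ((N : ℝ) / n) + s / Real.sqrt (np N) := by
  have hN' : (4 : ℝ) ≤ N := by exact_mod_cast hN
  have h' : 3 * (N : ℝ) ≤ n := by exact_mod_cast h
  have hd : (0 : ℝ) < (n : ℝ) - N := by linarith
  have hL : 0 < lam n N := by unfold lam; linarith
  have hnp : 0 < np n := by unfold np; positivity
  have hNp : 0 < np N := by unfold np; positivity
  have hS : 0 < sig n N := by unfold sig; positivity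
  set u : ℝ := np N / ((n : ℝ) - N) with hu
  have hu0 : 0 < u := by positivity
  have hl : ell n N = 1 + 2 * u := by
    rw [hu]; unfold ell kap lam np; field_simp; ring
  have hB : 0 < beta n N := by
    unfold beta; rw [hl]; apply Real.sqrt_pos.2; linarith
  have hr : Real.sqrt (ell n N ^ 2 - 1) = Real.sqrt (1 + u) * beta n N := by
    unfold beta; rw [hl, ← Real.sqrt_mul (by positivity)]; congr 1; ring
  have hBL : beta n N * lam n N = Real.sqrt (np N) * Real.sqrt ((n : ℝ) - N) := by
    unfold beta
    rw [hl, ← Real.sqrt_mul hNp.le]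
    nth_rewrite 1 [← Real.sqrt_sq hL.le]
    rw [← Real.sqrt_mul (by linarith)]
    congr 1
    rw [hu]; unfold lam; field_simp; ring
  unfold x2
  rw [aux_identity _ _ _ _ _ _ hL hs hS hB (Real.sq_sqrt (by rw [hl]; nlinarith)), hr, hBL,
    mul_div_assoc, div_self hB.ne', mul_one]
  have h2N : 2 ≤ Real.sqrt (np N) := Real.le_sqrt_of_sq_le (by unfold np; linarith)
  have h2n : 2 ≤ Real.sqrt (np n) := Real.le_sqrt_of_sq_le (by unfold np; linarith)
  have hmono : Real.sqrt (np N) ≤ Real.sqrt (np n) :=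
    Real.sqrt_le_sqrt (by unfold np; linarith)
  have hsig : sig n N ≤ 2 * Real.sqrt (np n) := by
    have h1 : (1 / Real.sqrt (np n) + 1 / Real.sqrt (np N)) ^ ((1 : ℝ) / 3) ≤ 1 := by
      apply Real.rpow_le_one (by positivity) _ (by norm_num)
      have := one_div_le_one_div_of_le (by norm_num) h2N
      have := one_div_le_one_div_of_le (by norm_num) h2n
      linarith
    calc sig n N ≤ (Real.sqrt (np n) + Real.sqrt (np N)) * 1 := by
          unfold sig; gcongr
      _ ≤ _ := by linarith
  have hdn : Real.sqrt (np n) ≤ 2 * Real.sqrt ((n : ℝ) - N) := by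
    apply Real.sqrt_le_iff.2 ⟨by positivity, _⟩
    rw [mul_pow, Real.sq_sqrt hd.le]; unfold np; linarith
  have hdp : 0 < Real.sqrt ((n : ℝ) - N) := Real.sqrt_pos.2 hd
  have hNs : 0 < Real.sqrt (np N) := by linarith
  have hT : sig n N / (4 * (Real.sqrt (np N) * Real.sqrt ((n : ℝ) - N)))
      ≤ 1 / Real.sqrt (np N) := by
    rw [div_le_div_iff₀ (by positivity) hNs]
    nlinarith
  have hT' := mul_le_mul_of_nonneg_left hT hs.le
  have hT0 : 0 < s * (sig n N / (4 * (Real.sqrt (np N) * Real.sqrt ((n : ℝ) - N)))) := by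
    positivity
  have h1 : 1 ≤ Real.sqrt (1 + u) := Real.le_sqrt_of_sq_le (by linarith)
  have h2 : Real.sqrt (1 + u) ≤ 1 + u :=
    Real.sqrt_le_iff.2 ⟨by positivity, by nlinarith⟩
  have h3 : u ≤ 3 * ((N : ℝ) / n) := by
    rw [hu, ← mul_div_assoc, div_le_div_iff₀ hd (by linarith)]
    unfold np; nlinarith
  rw [mul_one_div] at hT'
  rw [abs_of_nonneg (by linarith)]
  linarith

/-- Under AB, uniformly for `s ∈ [a,b] ⊂ (0,∞)`,
`λ·(x(s)² − 4l·x(s) + 4)/(4·s·β·σ) → 1`, where `x(s) = x₂ + sσ/λ`. -/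
theorem quadratic_uniform_estimate (a b : ℝ) (ha : 0 < a) (hab : a < b)
    (n : ℕ → ℕ) (hn : ∀ N, N < n N)
    (hAB : Tendsto (fun N : ℕ => (n N : ℝ) / N) atTop atTop) :
    ∀ ε > 0, ∃ N₀ : ℕ, ∀ N ≥ N₀, ∀ s ∈ Set.Icc a b,
      |lam (n N) N *
          ((x2 (n N) N + s * sig (n N) N / lam (n N) N) ^ 2
            - 4 * ell (n N) N * (x2 (n N) N + s * sig (n N) N / lam (n N) N) + 4) /
          (4 * s * beta (n N) N * sig (n N) N) - 1| < ε := by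
  intro ε hε
  have hb : 0 < b := ha.trans hab
  have h1 : Tendsto (fun N : ℕ => 3 * ((N : ℝ) / n N)) atTop (nhds (3 * 0)) := by
    apply Tendsto.const_mul
    refine hAB.inv_tendsto_atTop.congr fun N => ?_
    simp
  have h2 : Tendsto (fun N : ℕ => b / Real.sqrt (np N)) atTop (nhds 0) := by
    apply Tendsto.const_div_atTop
    apply Real.tendsto_sqrt_atTop.comp
    exact tendsto_atTop_add_const_right _ _ tendsto_natCast_atTop_atTop
  have h3 := h1.add h2
  rw [mul_zero, add_zero] at h3
  have h4 := h3.eventually (gt_mem_nhds hε)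
  have h5 := hAB.eventually_ge_atTop 3
  obtain ⟨N₀, hN₀⟩ := eventually_atTop.1 (h4.and (h5.and (eventually_ge_atTop 4)))
  refine ⟨N₀, fun N hN s hs => ?_⟩
  obtain ⟨h6, h7, h8⟩ := hN₀ N hN
  have hNpos : (0 : ℝ) < N := by exact_mod_cast (by omega : 0 < N)
  rw [le_div_iff₀ hNpos] at h7
  refine (aux_bound (n N) N h8 (by exact_mod_cast h7) s (ha.trans_le hs.1)).trans_lt
    (lt_of_le_of_lt ?_ h6)
  have := hs.2
  gcongr
end

section
/- For every fixed real s > 0, under AB one has σ²·g(x₂ + sσ/λ) → s, where g(t) = (t² − 4lt + 4)/(4t²). -/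
open Filter

noncomputable def g (l t : ℝ) : ℝ := (t ^ 2 - 4 * l * t + 4) / (4 * t ^ 2)

lemma key_id (s a b c : ℝ) (hs : 0 < s) (hb : 0 < b) (hab : b < a) (hc : 0 < c)
    (hc3 : c ^ 3 * (a * b) = a + b) :
    ((a + b) * c) ^ 2 * g ((a ^ 2 + b ^ 2) / (a ^ 2 - b ^ 2))
      (2 * (a + b) / (a - b) + s * ((a + b) * c) / ((a ^ 2 - b ^ 2) / 2))
    = s * (1 + s / 4 * ((a + b) * c / (a * b))) / (1 + s * (c / (a + b))) ^ 2 := by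
  have ha : 0 < a := hb.trans hab
  have hd : 0 < a - b := sub_pos.2 hab
  have hp : 0 < a + b := by positivity
  have hq : a ^ 2 - b ^ 2 = (a - b) * (a + b) := by ring
  have ht : 2 * (a + b) / (a - b) + s * ((a + b) * c) / ((a ^ 2 - b ^ 2) / 2)
      = 2 * (a + b + s * c) / (a - b) := by
    rw [hq]; field_simp
  have hr : 0 < a + b + s * c := by positivity
  have e : (1 + s * (c / (a + b))) = (a + b + s * c) / (a + b) := by field_simp
  rw [ht, g, hq, e]
  have e2 : (2 * (a + b + s * c) / (a - b)) ^ 2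
      - 4 * ((a ^ 2 + b ^ 2) / ((a - b) * (a + b))) * (2 * (a + b + s * c) / (a - b)) + 4
      = 4 * (s * c) * (s * c * (a + b) + 4 * a * b) / ((a - b) ^ 2 * (a + b)) := by
    field_simp
    ring
  have e3 : s * (1 + s / 4 * ((a + b) * c / (a * b)))
      = s * c ^ 3 * (a * b + s / 4 * (a + b) * c) / (a + b) := by
    field_simp
    linear_combination -hc3
  rw [e2, e3]
  field_simp
  ring

theorem sigma_sq_g_limit (s : ℝ) (hs : 0 < s) (n : ℕ → ℕ) (hn : ∀ N, N < n N)
    (hAB : Tendsto (fun N : ℕ => (n N : ℝ) / N) atTop atTop) :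
    Tendsto (fun N : ℕ =>
        sig (n N) N ^ 2 *
          g (ell (n N) N) (x2 (n N) N + s * sig (n N) N / lam (n N) N))
      atTop (nhds s) := by
  have hb : ∀ m : ℕ, 0 < Real.sqrt (np m) := fun m => Real.sqrt_pos.2 (by unfold np; positivity)
  have hsq : ∀ m : ℕ, Real.sqrt (np m) ^ 2 = m + 1/2 := fun m =>
    Real.sq_sqrt (by unfold np; positivity)
  have hlt : ∀ N, Real.sqrt (np N) < Real.sqrt (np (n N)) := fun N => by
    apply Real.sqrt_lt_sqrt (by unfold np; positivity)
    have : (N : ℝ) < n N := by exact_mod_cast hn N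
    unfold np; linarith
  set a : ℕ → ℝ := fun N => Real.sqrt (np (n N)) with hadef
  set b : ℕ → ℝ := fun N => Real.sqrt (np N) with hbdef
  set u : ℕ → ℝ := fun N => 1 / a N + 1 / b N with hu
  set c : ℕ → ℝ := fun N => u N ^ ((1 : ℝ) / 3) with hcdef
  have hbp : ∀ N, 0 < b N := fun N => hb N
  have hap : ∀ N, 0 < a N := fun N => hb _
  have hab : ∀ N, b N < a N := hlt
  have hup : ∀ N, 0 < u N := fun N => by
    have := hbp N; have := hap N; simp only [hu]; positivity
  have hcp : ∀ N, 0 < c N := fun N => Real.rpow_pos_of_pos (hup N) _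
  have hc3 : ∀ N, c N ^ 3 = u N := fun N => by
    simp only [hcdef]
    rw [← Real.rpow_natCast, ← Real.rpow_mul (hup N).le]; norm_num
  have hbt : Tendsto b atTop atTop := by
    apply Real.tendsto_sqrt_atTop.comp
    exact tendsto_atTop_add_const_right _ _ tendsto_natCast_atTop_atTop
  have hat : Tendsto a atTop atTop := tendsto_atTop_mono (fun N => (hab N).le) hbt
  have hut : Tendsto u atTop (nhds 0) := by
    have := (tendsto_const_nhds (x := (1:ℝ))).div_atTop hat |>.add
      ((tendsto_const_nhds (x := (1:ℝ))).div_atTop hbt)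
    simpa [hu] using this
  have hct : Tendsto c atTop (nhds 0) := by
    have := hut.rpow_const (p := (1:ℝ)/3) (Or.inr (by norm_num))
    simpa [hcdef] using this
  have hlim : Tendsto (fun N => s * (1 + s / 4 * (u N * c N)) /
      (1 + s * (c N / (a N + b N))) ^ 2) atTop (nhds s) := by
    have h1 := (((hut.mul hct).const_mul (s/4)).const_add 1).const_mul s
    have h2 := ((((hct.div_atTop (hat.atTop_add_atTop hbt)).const_mul s).const_add 1).pow 2)
    have := h1.div h2 (by norm_num)
    simp only [mul_zero, add_zero, one_pow, mul_one, div_one] at this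
    exact this
  refine hlim.congr fun N => ?_
  have h1 := hap N
  have h2 := hbp N
  have h3 := hab N
  have hd : 0 < a N - b N := sub_pos.2 h3
  have hs1 : a N ^ 2 = n N + 1/2 := hsq _
  have hs2 : b N ^ 2 = N + 1/2 := hsq _
  have hlam : lam (n N) N = (a N ^ 2 - b N ^ 2) / 2 := by rw [lam, hs1, hs2]; ring
  have hkap : kap (n N) N = (a N ^ 2 + b N ^ 2) / 2 := by rw [kap, hs1, hs2]; ring
  have hq : a N ^ 2 - b N ^ 2 = (a N - b N) * (a N + b N) := by ring
  have hell : ell (n N) N = (a N ^ 2 + b N ^ 2) / (a N ^ 2 - b N ^ 2) := by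
    rw [ell, hlam, hkap, hq]; field_simp
  have hx2 : x2 (n N) N = 2 * (a N + b N) / (a N - b N) := by
    have : ell (n N) N ^ 2 - 1 = (2 * a N * b N / ((a N - b N) * (a N + b N))) ^ 2 := by
      rw [hell, hq]; field_simp; ring
    rw [x2, this, Real.sqrt_sq (by positivity), hell, hq]; field_simp; ring
  have hsig : sig (n N) N = (a N + b N) * c N := rfl
  have huN : u N = (a N + b N) / (a N * b N) := by
    simp only [hu]; field_simp; ring
  rw [hsig, hell, hx2, hlam, key_id s (a N) (b N) (c N) hs h2 h3 (hcp N)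
    (by rw [hc3, huN]; field_simp), huN]
  congr 4
  ring
end

section
/- There exists s₁ > 0 such that, under AB, there is N₀ with the following property: for all N ≥ N₀ and all s ≥ 2s₁, λ · ∫_{x₂}^{x₂ + sσ/λ} √(g(t)) dt ≥ s. (This is property (P1) of Appendix A5, which yields the exponential bound on the rescaled Laguerre functions for large positive s.) -/
open Filter

lemma core_bound (l x d L S s : ℝ) (hx : 0 < x) (hd : 0 < d) (hdx : d ≤ x) (hL : 0 < L)
    (hS : 0 < S) (h1 : 16 * S ≤ L * x) (h2 : S ^ 3 * d = 4 * L * x ^ 2) (hs : 32 ≤ s)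
    (hg : ∀ t, t ^ 2 - 4 * l * t + 4 = (t - x) * (t - x + d)) :
    s ≤ L * ∫ t in x..(x + s * S / L), Real.sqrt (g l t) := by
  set u := s / 2 * S / L with hu
  have hu0 : 0 < u := by positivity
  have hsu : x + s * S / L = x + u + u := by rw [hu]; ring
  have hLu : L * u = s / 2 * S := by rw [hu]; field_simp
  have hcont : ∀ p q, x ≤ p → p ≤ q →
      IntervalIntegrable (fun t => Real.sqrt (g l t)) MeasureTheory.volume p q := by
    intro p q hp hq
    apply ContinuousOn.intervalIntegrable
    rw [Set.uIcc_of_le hq]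
    unfold g
    apply ContinuousOn.sqrt
    apply ContinuousOn.div (by fun_prop) (by fun_prop)
    intro t ht
    have : 0 < t := by linarith [ht.1]
    positivity
  rw [hsu, ← intervalIntegral.integral_add_adjacent_intervals
    (hcont x (x + u) le_rfl (by linarith)) (hcont (x + u) (x + u + u) (by linarith) (by linarith))]
  have hA : 0 ≤ ∫ t in x..(x + u), Real.sqrt (g l t) :=
    intervalIntegral.integral_nonneg (by linarith) (fun t _ => Real.sqrt_nonneg _)
  have hB : u * (2 / S) ≤ ∫ t in (x + u)..(x + u + u), Real.sqrt (g l t) := by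
    have := intervalIntegral.integral_mono_on (a := x + u) (b := x + u + u)
      (f := fun _ => 2 / S) (g := fun t => Real.sqrt (g l t)) (μ := MeasureTheory.volume)
      (by linarith) (by simp) (hcont (x + u) (x + u + u) (by linarith) (by linarith)) ?_
    · simpa [mul_div_assoc] using this
    · intro t ht
      apply Real.le_sqrt_of_sq_le
      unfold g
      rw [hg t]
      obtain ⟨v, rfl⟩ : ∃ v, t = x + v := ⟨t - x, by ring⟩
      have hv : u ≤ v := by linarith [ht.1]
      have hv0 : 0 < v := by linarith
      have hw : 16 * S / L ≤ v := by
        rw [div_le_iff₀ hL]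
        nlinarith
      set w := 16 * S / L with hwd
      have hw0 : 0 < w := by positivity
      have hwx : w ≤ x := by rw [hwd, div_le_iff₀ hL]; linarith
      have e1 : w / (2 * x) ≤ v / (x + v) := by
        rw [div_le_div_iff₀ (by positivity) (by positivity)]
        nlinarith
      have e2 : d / x ≤ (v + d) / (x + v) := by
        rw [div_le_div_iff₀ (by positivity) (by positivity)]
        nlinarith
      have e3 : w / (2 * x) * (d / x) ≤ v / (x + v) * ((v + d) / (x + v)) :=
        mul_le_mul e1 e2 (by positivity) (by positivity)
      have e4 : (2 / S) ^ 2 = w / (2 * x) * (d / x) / 8 * (16 / 16) := by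
        rw [hwd]
        field_simp
        nlinarith
      have e5 : (x + v - x) * (x + v - x + d) / (4 * (x + v) ^ 2)
          = v / (x + v) * ((v + d) / (x + v)) / 4 := by
        field_simp
        ring
      rw [e5, e4]
      have : 0 < w / (2 * x) * (d / x) := by positivity
      linarith
  have hC : s = L * (u * (2 / S)) := by
    rw [← mul_assoc, hLu]; field_simp
  calc s = L * (u * (2 / S)) := hC
    _ ≤ _ := by gcongr; linarith

/-- (P1): there is `s₁ > 0` such that under AB, for `N` large enough and every
`s ≥ 2s₁`, `λ·∫_{x₂}^{x₂ + sσ/λ} √(g(t)) dt ≥ s`. -/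
theorem exponent_lower_bound :
    ∃ s₁ : ℝ, 0 < s₁ ∧
      ∀ n : ℕ → ℕ, (∀ N, N < n N) →
        Tendsto (fun N : ℕ => (n N : ℝ) / N) atTop atTop →
        ∃ N₀ : ℕ, ∀ N ≥ N₀, ∀ s : ℝ, 2 * s₁ ≤ s →
          s ≤ lam (n N) N *
            ∫ t in (x2 (n N) N)..(x2 (n N) N + s * sig (n N) N / lam (n N) N),
              Real.sqrt (g (ell (n N) N) t) := by
  refine ⟨16, by norm_num, fun n hn _ => ⟨32, fun N hN s hs => ?_⟩⟩
  have hnN := hn N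
  generalize n N = m at hnN
  set a := Real.sqrt (np m) with ha
  set b := Real.sqrt (np N) with hb
  have hnm : (0:ℝ) < np m := by unfold np; positivity
  have hnn : (0:ℝ) < np N := by unfold np; positivity
  have hlt : np N < np m := by
    unfold np
    have : (N:ℝ) < m := by exact_mod_cast hnN
    linarith
  have hb0 : 0 < b := Real.sqrt_pos.2 hnn
  have hab : b < a := Real.sqrt_lt_sqrt hnn.le hlt
  have ha0 : 0 < a := hb0.trans hab
  have ha2 : a ^ 2 = m + 1 / 2 := Real.sq_sqrt hnm.le
  have hb2 : b ^ 2 = N + 1 / 2 := Real.sq_sqrt hnn.le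
  have hb32 : 32 ≤ b ^ 2 := by
    have : (32:ℝ) ≤ N := by exact_mod_cast hN
    linarith
  have hlam : lam m N = (a ^ 2 - b ^ 2) / 2 := by unfold lam; rw [ha2, hb2]; ring
  have hkap : kap m N = (a ^ 2 + b ^ 2) / 2 := by unfold kap; rw [ha2, hb2]; ring
  have hD : 0 < a - b := by linarith
  have hfac : a ^ 2 - b ^ 2 = (a - b) * (a + b) := by ring
  have hell : ell m N = (a ^ 2 + b ^ 2) / ((a - b) * (a + b)) := by
    unfold ell; rw [hlam, hkap, hfac]; field_simp
  have hsq : Real.sqrt (ell m N ^ 2 - 1) = 2 * a * b / ((a - b) * (a + b)) := by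
    rw [Real.sqrt_eq_iff_mul_self_eq_of_pos (by positivity), hell]
    field_simp
    ring
  have hx2 : x2 m N = 2 * (a + b) / (a - b) := by
    unfold x2; rw [hsq, hell]; field_simp; ring
  obtain ⟨c, hc⟩ : ∃ c, c = (1 / a + 1 / b) ^ ((1 : ℝ) / 3) := ⟨_, rfl⟩
  have hc0 : 0 < c := by rw [hc]; positivity
  have hc3 : c ^ 3 = (a + b) / (a * b) := by
    rw [hc, ← Real.rpow_natCast, ← Real.rpow_mul (by positivity)]
    norm_num
    field_simp
    ring
  have hsig : sig m N = (a + b) * c := by rw [hc]; rfl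
  have hc16 : 16 * c ≤ a + b := by
    apply le_of_pow_le_pow_left₀ (n := 3) (by norm_num) (by positivity)
    rw [mul_pow, hc3, mul_div_assoc', div_le_iff₀ (by positivity)]
    have k1 : 32 ≤ a * b := by nlinarith
    have k2 : 128 ≤ (a + b) ^ 2 := by nlinarith
    have k3 : 32 * 128 ≤ (a * b) * (a + b) ^ 2 := by
      apply mul_le_mul k1 k2 (by norm_num) (by positivity)
    calc 16 ^ 3 * (a + b) = 32 * 128 * (a + b) := by norm_num
      _ ≤ (a * b) * (a + b) ^ 2 * (a + b) := by gcongr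
      _ = _ := by ring
  apply core_bound (d := 8 * a * b / ((a - b) * (a + b)))
  · rw [hx2]; positivity
  · positivity
  · rw [hx2, div_le_div_iff₀ (by positivity) (by positivity)]
    have : 8 * a * b ≤ 2 * (a + b) * (a + b) := by nlinarith [sq_nonneg (a - b)]
    calc 8 * a * b * (a - b) ≤ 2 * (a + b) * (a + b) * (a - b) := by gcongr
      _ = _ := by ring
  · rw [hlam, hfac]; positivity
  · rw [hsig]; positivity
  · rw [hsig, hlam, hx2]
    have : (a ^ 2 - b ^ 2) / 2 * (2 * (a + b) / (a - b)) = (a + b) * (a + b) := by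
      field_simp; ring
    rw [this]
    calc 16 * ((a + b) * c) = (a + b) * (16 * c) := by ring
      _ ≤ _ := by gcongr
  · rw [hsig, hlam, hx2, mul_pow, hc3, hfac]
    field_simp
    try ring
  · linarith
  · intro t
    rw [hell, hx2]
    field_simp
    ring
end

section
/- For all real numbers 0 ≤ a < b, under AB one has sup_{s ∈ [a,b]} | ( (3/2)·λ·∫_{x₂}^{x₂ + sσ/λ} √(g(t)) dt )^{2/3} − s | → 0. (This is property (P2) of Appendix A5: with η defined by (2/3)β²η^{3/2} = ∫_{x₂}^{x} √g and using λβ² = 2N + 1, it says (2N+1)^{2/3}·η = s + o(1) uniformly on [a,b].) -/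
open Filter

lemma aux_int (c h : ℝ) (hh : 0 ≤ h) :
    ∫ t in c..(c + h), Real.sqrt (t - c) = 2 / 3 * (h * Real.sqrt h) := by
  rw [intervalIntegral.integral_comp_sub_right (fun t => Real.sqrt t) c]
  simp only [Real.sqrt_eq_rpow, sub_self, add_sub_cancel_left]
  rw [integral_rpow (Or.inl (by norm_num))]
  have : h ^ ((1:ℝ)/2 + 1) = h * h ^ ((1:ℝ)/2) := by
    rw [add_comm, Real.rpow_add' hh (by norm_num), Real.rpow_one]
  rw [this, Real.zero_rpow (by norm_num)]
  ring

lemma aux_pow (s r I K : ℝ) (hs : 0 ≤ s) (hr : 0 ≤ r) (hK0 : 0 ≤ K) (hK : K ^ 2 = s ^ 3)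
    (h1 : K / (1 + r) ≤ I) (h2 : I ≤ K * (1 + r)) :
    |I ^ ((2:ℝ)/3) - s| ≤ s * r := by
  have hr1 : 0 < 1 + r := by linarith
  have hI : 0 ≤ I := le_trans (by positivity) h1
  set J := I ^ ((2:ℝ)/3) with hJ
  have hJ0 : 0 ≤ J := by positivity
  have hJ3 : J ^ 3 = I ^ 2 := by
    rw [hJ, ← Real.rpow_natCast, ← Real.rpow_mul hI, ← Real.rpow_natCast]
    norm_num
  have hup : J ≤ s * (1 + r) := by
    refine le_of_pow_le_pow_left₀ (n := 3) (by norm_num) (by positivity) ?_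
    rw [hJ3]
    calc I ^ 2 ≤ (K * (1 + r)) ^ 2 := by gcongr
      _ = s ^ 3 * (1 + r) ^ 2 := by rw [mul_pow, hK]
      _ ≤ s ^ 3 * (1 + r) ^ 3 := by
        gcongr
        · linarith
        · norm_num
      _ = _ := by ring
  have hlo : s ≤ J * (1 + r) := by
    refine le_of_pow_le_pow_left₀ (n := 3) (by norm_num) (by positivity) ?_
    rw [mul_pow, hJ3, ← hK]
    have : K ≤ I * (1 + r) := by rwa [div_le_iff₀ hr1] at h1
    calc K ^ 2 ≤ (I * (1 + r)) ^ 2 := by gcongr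
      _ = I ^ 2 * (1 + r) ^ 2 := by ring
      _ ≤ I ^ 2 * (1 + r) ^ 3 := by
        gcongr
        · linarith
        · norm_num
  rw [abs_le]
  constructor
  · by_cases hc : J ≤ s
    · nlinarith
    · have := mul_nonneg hs hr
      linarith
  · linarith

lemma aux_g (l x₁ x₂ t : ℝ) (h1 : x₁ + x₂ = 4 * l) (h2 : x₁ * x₂ = 4) :
    g l t = (t - x₁) * (t - x₂) / (4 * t ^ 2) := by
  unfold g
  congr 1
  linear_combination t * h1 - h2

/-- integral bounds -/
lemma aux_bounds (l x₁ x₂ h r : ℝ) (h1 : x₁ + x₂ = 4 * l) (h2 : x₁ * x₂ = 4)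
    (hx1 : 0 < x₁) (hx : x₁ < x₂) (hh : 0 ≤ h) (hr : h = r * (x₂ - x₁)) :
    let C := Real.sqrt ((x₂ - x₁) / (4 * x₂ ^ 2))
    (2 / 3 * C * (h * Real.sqrt h)) / (1 + r) ≤ (∫ t in x₂..(x₂ + h), Real.sqrt (g l t)) ∧
    (∫ t in x₂..(x₂ + h), Real.sqrt (g l t)) ≤ (2 / 3 * C * (h * Real.sqrt h)) * (1 + r) := by
  intro C
  have hd : 0 < x₂ - x₁ := by linarith
  have hx2 : 0 < x₂ := by linarith
  have hr0 : 0 ≤ r := by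
    by_contra hc
    push Not at hc
    nlinarith [mul_pos (neg_pos.2 hc) hd]
  have hr1 : 0 < 1 + r := by linarith
  have hC2 : C ^ 2 = (x₂ - x₁) / (4 * x₂ ^ 2) := Real.sq_sqrt (by positivity)
  have hC0 : 0 ≤ C := Real.sqrt_nonneg _
  have hle : x₂ ≤ x₂ + h := by linarith
  have hint : IntervalIntegrable (fun t => Real.sqrt (g l t)) MeasureTheory.volume x₂ (x₂ + h) := by
    apply ContinuousOn.intervalIntegrable
    rw [Set.uIcc_of_le hle]
    apply ContinuousOn.sqrt
    unfold g
    apply ContinuousOn.div (by fun_prop) (by fun_prop)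
    intro t ht
    have : 0 < t := lt_of_lt_of_le hx2 ht.1
    positivity
  have hint2 : ∀ k : ℝ, IntervalIntegrable (fun t => k * Real.sqrt (t - x₂)) MeasureTheory.volume x₂ (x₂ + h) := by
    intro k
    apply Continuous.intervalIntegrable
    fun_prop
  have hval : ∀ k : ℝ, ∫ t in x₂..(x₂ + h), k * Real.sqrt (t - x₂) = k * (2 / 3 * (h * Real.sqrt h)) := by
    intro k
    rw [intervalIntegral.integral_const_mul, aux_int _ _ hh]
  constructor
  · have e : (2 / 3 * C * (h * Real.sqrt h)) / (1 + r) = (C / (1 + r)) * (2 / 3 * (h * Real.sqrt h)) := by ring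
    rw [e, ← hval]
    refine intervalIntegral.integral_mono_on hle (hint2 _) hint ?_
    intro t ht
    have ht0 : 0 < t := lt_of_lt_of_le hx2 ht.1
    have htx : 0 ≤ t - x₂ := by linarith [ht.1]
    apply Real.le_sqrt_of_sq_le
    rw [aux_g l x₁ x₂ t h1 h2, mul_pow, div_pow, Real.sq_sqrt htx, hC2, mul_div_right_comm]
    apply mul_le_mul_of_nonneg_right _ htx
    rw [div_div, div_le_div_iff₀ (by positivity) (by positivity)]
    have ht2 : t ≤ x₂ * (1 + r) := by
      have := ht.2
      nlinarith [mul_nonneg hr0 hx1.le]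
    have : t ^ 2 ≤ (x₂ * (1 + r)) ^ 2 := by gcongr
    calc (x₂ - x₁) * (4 * t ^ 2) ≤ (x₂ - x₁) * (4 * (x₂ * (1 + r)) ^ 2) := by gcongr
      _ ≤ (t - x₁) * (4 * (x₂ * (1 + r)) ^ 2) := by
        gcongr
        linarith
      _ = _ := by ring
  · have e : (2 / 3 * C * (h * Real.sqrt h)) * (1 + r) = (C * (1 + r)) * (2 / 3 * (h * Real.sqrt h)) := by ring
    rw [e, ← hval]
    refine intervalIntegral.integral_mono_on hle hint (hint2 _) ?_
    intro t ht
    have ht0 : 0 < t := lt_of_lt_of_le hx2 ht.1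
    have htx : 0 ≤ t - x₂ := by linarith [ht.1]
    apply Real.sqrt_le_iff.2 ⟨by positivity, ?_⟩
    rw [aux_g l x₁ x₂ t h1 h2, mul_pow, mul_pow, Real.sq_sqrt htx, hC2, mul_div_right_comm]
    apply mul_le_mul_of_nonneg_right _ htx
    rw [div_mul_eq_mul_div, div_le_div_iff₀ (by positivity) (by positivity)]
    have htt : t - x₁ ≤ (x₂ - x₁) * (1 + r) := by linarith [ht.2]
    have : (x₂ - x₁) * (1 + r) ≤ (x₂ - x₁) * (1 + r) ^ 2 := by
      gcongr
      nlinarith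
    calc (t - x₁) * (4 * x₂ ^ 2) ≤ ((x₂ - x₁) * (1 + r) ^ 2) * (4 * x₂ ^ 2) := by
          gcongr
          linarith
      _ ≤ _ := by
        gcongr
        exact ht.1

lemma aux_main (n N : ℕ) (h : N < n) (hN : 1 ≤ N) (s : ℝ) (hs : 0 ≤ s) :
    |((3 / 2 : ℝ) * lam n N *
          ∫ t in (x2 n N)..(x2 n N + s * sig n N / lam n N),
            Real.sqrt (g (ell n N) t)) ^ ((2 : ℝ) / 3) - s| ≤ s * (s / Real.sqrt (np N)) := by
  obtain ⟨p, hp⟩ : ∃ p, p = Real.sqrt (np n) := ⟨_, rfl⟩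
  obtain ⟨q, hq⟩ : ∃ q, q = Real.sqrt (np N) := ⟨_, rfl⟩
  have hN' : (1:ℝ) ≤ N := by exact_mod_cast hN
  have hn' : (N:ℝ) < n := by exact_mod_cast h
  have hp2 : p ^ 2 = n + 1/2 := by
    rw [hp, Real.sq_sqrt (by unfold np; positivity)]; rfl
  have hq2 : q ^ 2 = N + 1/2 := by
    rw [hq, Real.sq_sqrt (by unfold np; positivity)]; rfl
  have hq0 : 0 ≤ q := hq ▸ Real.sqrt_nonneg _
  have hp0 : 0 ≤ p := hp ▸ Real.sqrt_nonneg _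
  have hq1 : 1 ≤ q := by nlinarith
  have hpq : q < p := by nlinarith
  have hqp : 0 < q := by linarith
  have hpp : 0 < p := by linarith
  have hd : 0 < p - q := by linarith
  have hlam : lam n N = (p ^ 2 - q ^ 2) / 2 := by unfold lam; rw [hp2, hq2]; ring
  have hlam' : lam n N = (p - q) * (p + q) / 2 := by rw [hlam]; ring
  have hell : ell n N = (p ^ 2 + q ^ 2) / ((p - q) * (p + q)) := by
    unfold ell
    rw [hlam', show kap n N = (p ^ 2 + q ^ 2) / 2 by unfold kap; rw [hp2, hq2]; ring]
    field_simp
  have hx2 : x2 n N = 2 * (p + q) / (p - q) := by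
    unfold x2
    have : ell n N ^ 2 - 1 = (2 * p * q / ((p - q) * (p + q))) ^ 2 := by
      rw [hell]; field_simp; ring
    rw [this, Real.sqrt_sq (by positivity), hell]
    field_simp
    ring
  obtain ⟨σ, hσ⟩ : ∃ σ, σ = sig n N := ⟨_, rfl⟩
  have hσ' : σ = (p + q) * (1 / p + 1 / q) ^ ((1 : ℝ) / 3) := by
    rw [hσ, hp, hq, sig]
  have hσ0 : 0 ≤ σ := by rw [hσ']; positivity
  have hσ3 : σ ^ 3 = (p + q) ^ 4 / (p * q) := by
    rw [hσ', mul_pow, ← Real.rpow_natCast (_ ^ ((1:ℝ)/3)), ← Real.rpow_mul (by positivity)]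
    norm_num
    field_simp
    ring
  have hσle : σ ≤ 4 * p := by
    refine le_of_pow_le_pow_left₀ (n := 3) (by norm_num) (by positivity) ?_
    rw [hσ3, div_le_iff₀ (by positivity)]
    calc (p + q) ^ 4 ≤ (p + p) ^ 4 := by gcongr
      _ = 16 * p ^ 4 := by ring
      _ ≤ 16 * p ^ 4 * q := le_mul_of_one_le_right (by positivity) hq1
      _ ≤ _ := by
        have : 0 ≤ p ^ 4 * q := by positivity
        nlinarith
  rw [← hσ, ← hq]
  set x₁ := 2 * (p - q) / (p + q) with hx₁
  have hx10 : 0 < x₁ := by positivity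
  have hlpos : 0 < lam n N := by rw [hlam']; positivity
  have hdiff : x2 n N - x₁ = 8 * p * q / ((p - q) * (p + q)) := by
    rw [hx2, hx₁]; field_simp; ring
  have hdpos : 0 < x2 n N - x₁ := by rw [hdiff]; positivity
  obtain ⟨r, hr⟩ : ∃ r, r = s * σ / (4 * p * q) := ⟨_, rfl⟩
  have hr0 : 0 ≤ r := by rw [hr]; positivity
  have hrle : r ≤ s / q := by
    rw [hr, div_le_div_iff₀ (by positivity) (by positivity)]
    have := mul_le_mul_of_nonneg_left hσle (mul_nonneg hs hq0)
    nlinarith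
  have hh0 : 0 ≤ s * σ / lam n N := by positivity
  have key := aux_bounds (ell n N) x₁ (x2 n N) (s * σ / lam n N) r
    (by rw [hx2, hx₁, hell]; field_simp; ring)
    (by rw [hx2, hx₁]; field_simp; norm_num)
    hx10 (by linarith) hh0
    (by rw [hdiff, hr, hlam']; field_simp; ring)
  simp only at key
  obtain ⟨k1, k2⟩ := key
  set C := Real.sqrt ((x2 n N - x₁) / (4 * (x2 n N) ^ 2)) with hC
  have hC2 : C ^ 2 = (x2 n N - x₁) / (4 * (x2 n N) ^ 2) := Real.sq_sqrt (by positivity)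
  have hC2' : C ^ 2 = p * q * (p - q) / (2 * (p + q) ^ 3) := by
    rw [hC2, hdiff, hx2]; field_simp; ring
  set H := s * σ / lam n N with hH
  have hsq : Real.sqrt H ^ 2 = H := Real.sq_sqrt hh0
  refine le_trans (aux_pow s r _ (lam n N * C * (H * Real.sqrt H)) hs hr0 (by positivity) ?_ ?_ ?_)
    (mul_le_mul_of_nonneg_left hrle hs)
  · have : (lam n N * C * (H * Real.sqrt H)) ^ 2 = lam n N ^ 2 * C ^ 2 * H ^ 3 := by
      rw [show (lam n N * C * (H * Real.sqrt H)) ^ 2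
        = lam n N ^ 2 * C ^ 2 * H ^ 2 * (Real.sqrt H) ^ 2 by ring, hsq]
      ring
    rw [this, hC2', hH, div_pow, mul_pow, hσ3, hlam']
    field_simp
  · have := mul_le_mul_of_nonneg_left k1 (show 0 ≤ 3 / 2 * lam n N by positivity)
    refine le_trans (le_of_eq ?_) this
    ring
  · have := mul_le_mul_of_nonneg_left k2 (show 0 ≤ 3 / 2 * lam n N by positivity)
    refine le_trans this (le_of_eq ?_)
    ring

/-- (P2): for `0 ≤ a < b`, under AB, uniformly on `s ∈ [a,b]`,
`((3/2)·λ·∫_{x₂}^{x₂ + sσ/λ} √g)^{2/3} → s`; i.e. `(2N+1)^{2/3}η = s + o(1)`. -/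
theorem eta_uniform_estimate (a b : ℝ) (ha : 0 ≤ a) (hab : a < b)
    (n : ℕ → ℕ) (hn : ∀ N, N < n N)
    (hAB : Tendsto (fun N : ℕ => (n N : ℝ) / N) atTop atTop) :
    ∀ ε > 0, ∃ N₀ : ℕ, ∀ N ≥ N₀, ∀ s ∈ Set.Icc a b,
      |((3 / 2 : ℝ) * lam (n N) N *
          ∫ t in (x2 (n N) N)..(x2 (n N) N + s * sig (n N) N / lam (n N) N),
            Real.sqrt (g (ell (n N) N) t)) ^ ((2 : ℝ) / 3) - s| < ε := by
  intro ε hε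
  obtain ⟨M, hM⟩ := exists_nat_gt ((b * b / ε) ^ 2)
  refine ⟨max M 1, fun N hN s hs => ?_⟩
  have hN1 : 1 ≤ N := le_trans (le_max_right _ _) hN
  have hNM : (M:ℝ) ≤ N := by exact_mod_cast le_trans (le_max_left _ _) hN
  have hs0 : 0 ≤ s := ha.trans hs.1
  have hb : 0 < b := by linarith
  refine lt_of_le_of_lt (aux_main (n N) N (hn N) hN1 s hs0) ?_
  have hnp : 0 < np N := by unfold np; positivity
  have hq : b * b / ε < Real.sqrt (np N) := by
    apply Real.lt_sqrt_of_sq_lt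
    unfold np
    linarith
  have hq0 : 0 < Real.sqrt (np N) := Real.sqrt_pos.2 hnp
  have : s * s ≤ b * b := mul_self_le_mul_self hs0 hs.2
  rw [← mul_div_assoc, div_lt_iff₀ hq0]
  rw [div_lt_iff₀ hε] at hq
  linarith
end

section
/- Under AB, the constant K_{n,N} = (2λ)^{1/4} · ((n + 1/2)/e)^{(n+1/2)/2} · √2 · π^{1/4} · √(N!) · β^{1/2} / ( (2N+1)^{1/12} · √(n! · N! · σ) ) satisfies K_{n,N} · (n/N)^{1/4} / 2^{2/3} → 1; that is, K_{n,N} ~ 2^{2/3}(N/n)^{1/4}. -/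
open Filter

/-- The constant
`K_{n,N} = (2λ)^{1/4}·((n+1/2)/e)^{(n+1/2)/2}·√2·π^{1/4}·√(N!)·β^{1/2}
            / ((2N+1)^{1/12}·√(n!·N!·σ))`. -/
noncomputable def K (n N : ℕ) : ℝ :=
  (2 * lam n N) ^ ((1 : ℝ) / 4) * (np n / Real.exp 1) ^ (np n / 2) *
      Real.sqrt 2 * Real.pi ^ ((1 : ℝ) / 4) *
      Real.sqrt (Nat.factorial N) * (beta n N) ^ ((1 : ℝ) / 2) /
    ((2 * (N : ℝ) + 1) ^ ((1 : ℝ) / 12) *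
      Real.sqrt ((Nat.factorial n : ℝ) * (Nat.factorial N : ℝ) * sig n N))


theorem K_log_formula (n N : ℕ) (hN : 1 ≤ N) (h : N < n) :
    K n N * ((n : ℝ) / N) ^ ((1 : ℝ) / 4) / (2 : ℝ) ^ ((2 : ℝ) / 3) =
    Real.exp ((1/4) * Real.log (1 + (1/2) / (N:ℝ)) -
      (2/3) * Real.log (1 + Real.sqrt (np N / np n)) +
      ((1/4) * Real.log Real.pi - (1/2) * Real.log (Stirling.stirlingSeq n)) +
      ((1/2) * ((n:ℝ) * Real.log (1 + (1/2) / (n:ℝ))) - 1/4)) := by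
  have hN0 : (0:ℝ) < N := by exact_mod_cast hN
  have hnN : (N:ℝ) < n := by exact_mod_cast h
  have hn0 : (0:ℝ) < n := hN0.trans hnN
  have hnp : 0 < np n := by unfold np; positivity
  have hNp : 0 < np N := by unfold np; positivity
  have hlam : 0 < lam n N := by unfold lam; linarith
  have hbe : 2 * (ell n N - 1) = (2 * (N:ℝ) + 1) / lam n N := by
    unfold ell
    field_simp
    unfold kap lam
    ring
  have hb0 : 0 < beta n N := by
    unfold beta; rw [hbe]; positivity
  have hlb : Real.log (beta n N) = (Real.log (2 * (N:ℝ) + 1) - Real.log (lam n N)) / 2 := by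
    unfold beta
    rw [hbe, Real.log_sqrt (by positivity), Real.log_div (by positivity) (by positivity)]
  have hsn : 0 < Real.sqrt (np n) := Real.sqrt_pos.2 hnp
  have hsN : 0 < Real.sqrt (np N) := Real.sqrt_pos.2 hNp
  have hsig0 : 0 < sig n N := by unfold sig; positivity
  have hT : Real.sqrt (np n) + Real.sqrt (np N) =
      Real.sqrt (np n) * (1 + Real.sqrt (np N / np n)) := by
    rw [Real.sqrt_div hNp.le]; field_simp
  have hS : 1 / Real.sqrt (np n) + 1 / Real.sqrt (np N) =
      (1 + Real.sqrt (np N / np n)) / Real.sqrt (np N) := by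
    rw [Real.sqrt_div hNp.le]; field_simp; ring
  have hT0 : 0 < 1 + Real.sqrt (np N / np n) := by positivity
  have hlsig : Real.log (sig n N) = 1/2 * Real.log (np n) - 1/6 * Real.log (np N)
      + 4/3 * Real.log (1 + Real.sqrt (np N / np n)) := by
    unfold sig
    rw [hS, hT, Real.log_mul (by positivity) (by positivity), Real.log_rpow (by positivity),
      Real.log_mul (by positivity) (by positivity), Real.log_div (by positivity) (by positivity),
      Real.log_sqrt hnp.le, Real.log_sqrt hNp.le]
    ring
  have hlNp : Real.log (np N) = Real.log (2 * (N:ℝ) + 1) - Real.log 2 := by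
    rw [← Real.log_div (by positivity) (by positivity)]
    congr 1; unfold np; ring
  have h1 : Real.log (1 + (1/2) / (N:ℝ)) =
      Real.log (2 * (N:ℝ) + 1) - Real.log 2 - Real.log N := by
    rw [← hlNp, ← Real.log_div (by positivity) (by positivity)]
    congr 1; unfold np; field_simp
  have h2 : Real.log (1 + (1/2) / (n:ℝ)) = Real.log (np n) - Real.log n := by
    rw [← Real.log_div (by positivity) (by positivity)]
    congr 1; unfold np; field_simp
  have hst := Stirling.log_stirlingSeq_formula n
  rw [Real.log_div (by positivity) (by positivity), Real.log_exp,
    Real.log_mul (by positivity) (by positivity)] at hst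
  have hfn : (0:ℝ) < (Nat.factorial n : ℝ) := by positivity
  have hfN : (0:ℝ) < (Nat.factorial N : ℝ) := by positivity
  have hpos : 0 < K n N * ((n : ℝ) / N) ^ ((1 : ℝ) / 4) / (2 : ℝ) ^ ((2 : ℝ) / 3) := by
    unfold K; positivity
  rw [← Real.exp_log hpos]
  congr 1
  have hE := Real.exp_pos 1
  have hpi := Real.pi_pos
  unfold K
  rw [Real.log_div (by positivity) (by positivity), Real.log_mul (by positivity) (by positivity),
    Real.log_div (by positivity) (by positivity)]
  rw [Real.log_mul (x := (2 * (N : ℝ) + 1) ^ ((1 : ℝ) / 12)) (by positivity) (by positivity)]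
  iterate 5 rw [Real.log_mul (by positivity) (by positivity)]
  rw [Real.log_sqrt (x := (Nat.factorial n : ℝ) * (Nat.factorial N : ℝ) * sig n N) (by positivity),
    Real.log_sqrt (x := (Nat.factorial N : ℝ)) (by positivity),
    Real.log_sqrt (x := (2 : ℝ)) (by positivity),
    Real.log_mul (x := (Nat.factorial n : ℝ) * (Nat.factorial N : ℝ)) (by positivity) (by positivity),
    Real.log_mul (x := (Nat.factorial n : ℝ)) (by positivity) (by positivity)]
  rw [Real.log_rpow (x := 2 * lam n N) (by positivity), Real.log_rpow (x := np n / Real.exp 1) (by positivity),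
    Real.log_rpow hpi, Real.log_rpow hb0, Real.log_rpow (x := 2 * (N:ℝ) + 1) (by positivity),
    Real.log_rpow (x := (n:ℝ) / N) (by positivity), Real.log_rpow (x := (2:ℝ)) (by positivity),
    Real.log_mul (x := (2:ℝ)) (by positivity) (by positivity),
    Real.log_div (x := np n) (by positivity) (by positivity), Real.log_exp,
    Real.log_div (x := (n:ℝ)) (by positivity) (by positivity)]
  rw [h1, h2, hst, hlsig, hlb, hlNp]
  rw [show np n / 2 = ((n:ℝ) + 1/2) / 2 from rfl]
  ring

theorem K_asymptotics (n : ℕ → ℕ) (hn : ∀ N, N < n N)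
    (hAB : Tendsto (fun N : ℕ => (n N : ℝ) / N) atTop atTop) :
    Tendsto (fun N : ℕ =>
        K (n N) N * ((n N : ℝ) / N) ^ ((1 : ℝ) / 4) / (2 : ℝ) ^ ((2 : ℝ) / 3))
      atTop (nhds 1) := by
  have hnt : Tendsto n atTop atTop := tendsto_atTop_mono (fun N => (hn N).le) tendsto_id
  have hNr : Tendsto (fun N : ℕ => (N:ℝ)) atTop atTop := tendsto_natCast_atTop_atTop
  have hnr : Tendsto (fun N : ℕ => (n N:ℝ)) atTop atTop := hNr.comp hnt
  have t1 : Tendsto (fun N : ℕ => Real.log (1 + (1/2) / (N:ℝ))) atTop (nhds 0) := by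
    have := (hNr.const_div_atTop (1/2)).const_add 1
    rw [add_zero] at this
    simpa using this.log (by norm_num)
  have tq : Tendsto (fun N : ℕ => np N / np (n N)) atTop (nhds 0) := by
    have hz : Tendsto (fun N : ℕ => 2 * ((n N : ℝ) / N)⁻¹) atTop (nhds 0) := by
      simpa using hAB.inv_tendsto_atTop.const_mul 2
    refine squeeze_zero' (Eventually.of_forall fun N => ?_) ?_ hz
    · unfold np; positivity
    · filter_upwards [eventually_ge_atTop 1] with N hN
      have hN1 : (1:ℝ) ≤ N := by exact_mod_cast hN
      have hnN : (N:ℝ) < n N := by exact_mod_cast hn N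
      have : (0:ℝ) < n N := by linarith
      rw [inv_div, ← mul_div_assoc]
      unfold np
      apply div_le_div₀ <;> linarith
  have t2 : Tendsto (fun N : ℕ => Real.log (1 + Real.sqrt (np N / np (n N)))) atTop (nhds 0) := by
    have := tq.sqrt.const_add 1
    rw [Real.sqrt_zero, add_zero] at this
    simpa using this.log (by norm_num)
  have t3 : Tendsto (fun N : ℕ => Real.log (Stirling.stirlingSeq (n N))) atTop
      (nhds (Real.log (Real.sqrt Real.pi))) :=
    (Stirling.tendsto_stirlingSeq_sqrt_pi.comp hnt).log (by have := Real.pi_pos; positivity)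
  rw [Real.log_sqrt Real.pi_pos.le] at t3
  have t4 : Tendsto (fun N : ℕ => (n N:ℝ) * Real.log (1 + (1/2) / (n N:ℝ))) atTop (nhds (1/2)) :=
    (Real.tendsto_mul_log_one_add_div_atTop (1/2)).comp hnr
  have hall := (((t1.const_mul (1/4)).sub (t2.const_mul (2/3))).add
    ((t3.const_mul (1/2)).const_sub ((1/4) * Real.log Real.pi))).add
    ((t4.const_mul (1/2)).sub_const (1/4))
  have hexp := (Real.continuous_exp.tendsto _).comp hall
  have hlim : Real.exp (1/4 * 0 - 2/3 * 0 + (1/4 * Real.log Real.pi - 1/2 * (Real.log Real.pi / 2))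
      + (1/2 * (1/2) - 1/4)) = 1 := by
    rw [Real.exp_eq_one_iff]; ring
  rw [hlim] at hexp
  refine hexp.congr' ?_
  filter_upwards [eventually_ge_atTop 1] with N hN
  exact (K_log_formula (n N) N hN (hn N)).symm
end

section
/- Let α ≥ 1 and k ≥ 0 be integers. Then ∫_0^∞ x^{α/2 − 1} e^{−x/2} L_k^{(α−1)}(x) dx equals 2^{α/2} · Γ((α + k)/2) / (k/2)! when k is even, and equals 0 when k is odd. -/
open MeasureTheory

/-- The generalized Laguerre polynomial
`L_k^{(α)}(x) = Σ_{j=0}^{k} (−1)^j · C(k + α, k − j) · x^j / j!`. -/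
noncomputable def laguerre (k α : ℕ) (x : ℝ) : ℝ :=
  ∑ j ∈ Finset.range (k + 1),
    (-1 : ℝ) ^ j * (Nat.choose (k + α) (k - j) : ℝ) * x ^ j / (Nat.factorial j : ℝ)

noncomputable def lagT (b k j : ℕ) : ℝ :=
  (-1 : ℝ) ^ j * (Nat.choose (k + b) (k - j) : ℝ) / (Nat.factorial j : ℝ) *
    ((2 : ℝ) ^ j * Real.Gamma (((b : ℝ) + 1) / 2 + j))

lemma lagT_eq (b n j : ℕ) : lagT b (n + j) j =
    (-2 : ℝ) ^ j * ((n + j + b).factorial : ℝ) / (n.factorial * (b + j).factorial) /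
      (j.factorial : ℝ) * Real.Gamma (((b : ℝ) + 1) / 2 + j) := by
  have h : ((n + j + b).choose n : ℝ) =
      ((n + j + b).factorial : ℝ) / (n.factorial * (b + j).factorial) := by
    rw [Nat.cast_choose ℝ (by omega : n ≤ n + j + b)]
    congr 4
    omega
  unfold lagT
  rw [Nat.add_sub_cancel, h, show (-2 : ℝ) = (-1) * 2 by norm_num, mul_pow]
  ring

lemma gam_succ (b j : ℕ) : Real.Gamma (((b : ℝ) + 1) / 2 + (j + 1 : ℕ)) =
    (((b : ℝ) + 1) / 2 + j) * Real.Gamma (((b : ℝ) + 1) / 2 + j) := by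
  rw [← Real.Gamma_add_one (by positivity)]
  congr 1
  push_cast
  ring

lemma lag_partial (b : ℕ) (m : ℕ) : ∀ n : ℕ,
    ∑ j ∈ Finset.range (m + 1), (((n + m : ℕ) + 2 : ℝ) * lagT b (n + m + 2) j -
      ((n + m : ℕ) + b + 1 : ℝ) * lagT b (n + m) j) =
    2 * ((b : ℝ) + 1 + (n + m : ℕ)) * (((b : ℝ) + 1) / 2 + m) / (n + 1) * lagT b (n + m) m := by
  induction m with
  | zero =>
    intro n
    have h1 := lagT_eq b (n + 2) 0
    have h2 := lagT_eq b n 0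
    simp only [add_zero] at h1 h2
    simp only [zero_add, Finset.sum_range_one, add_zero]
    rw [h1, h2, show n + 2 + b = (n + b) + 1 + 1 by ring]
    simp only [Nat.factorial_succ]
    push_cast
    field_simp
    ring
  | succ m ih =>
    intro n
    rw [Finset.sum_range_succ]
    have h0 := ih (n + 1)
    rw [show n + 1 + m = n + (m + 1) by ring] at h0
    rw [h0]
    have h1 := lagT_eq b (n + 2) (m + 1)
    have h2 := lagT_eq b n (m + 1)
    have h3 := lagT_eq b (n + 1) m
    rw [show n + 1 + m = n + (m + 1) by ring] at h3
    rw [show n + 2 + (m + 1) = n + (m + 1) + 2 by ring] at h1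
    rw [h1, h2, h3, gam_succ, show n + (m + 1) + 2 + b = (n + (m + 1) + b) + 1 + 1 by ring,
      ← add_assoc b m 1]
    simp only [Nat.factorial_succ]
    push_cast
    field_simp
    ring

noncomputable def lagS (b k : ℕ) : ℝ := ∑ j ∈ Finset.range (k + 1), lagT b k j

lemma lagS_rec (b k : ℕ) : ((k : ℝ) + 2) * lagS b (k + 2) = ((k : ℝ) + b + 1) * lagS b k := by
  have h := lag_partial b k 0
  rw [Finset.sum_sub_distrib, ← Finset.mul_sum, ← Finset.mul_sum] at h
  simp only [zero_add] at h
  unfold lagS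
  rw [Finset.sum_range_succ _ (k + 2), Finset.sum_range_succ _ (k + 1)]
  have h1 := lagT_eq b 1 (k + 1)
  have h2 := lagT_eq b 0 (k + 2)
  have h3 := lagT_eq b 0 k
  rw [show 1 + (k + 1) = k + 2 by ring] at h1
  simp only [zero_add] at h2 h3
  have key : 2 * ((b : ℝ) + 1 + k) * (((b : ℝ) + 1) / 2 + k) / ((0 : ℕ) + 1) * lagT b k k +
      (k + 2) * (lagT b (k + 2) (k + 1) + lagT b (k + 2) (k + 2)) = 0 := by
    rw [h1, h2, h3, gam_succ b (k + 1), gam_succ b k,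
      show k + 2 + b = (k + b) + 1 + 1 by ring, show b + (k + 2) = (k + b) + 1 + 1 by ring,
      show b + (k + 1) = (k + b) + 1 by ring, add_comm b k]
    simp only [Nat.factorial_succ, Nat.factorial_zero]
    push_cast
    field_simp
    ring
  linarith

lemma lagS_zero (b : ℕ) : lagS b 0 = Real.Gamma (((b : ℝ) + 1) / 2) := by
  simp [lagS, lagT]

lemma lagS_one (b : ℕ) : lagS b 1 = 0 := by
  have h := gam_succ b 0
  simp only [lagS, lagT, Finset.sum_range_succ, Finset.sum_range_zero]
  rw [zero_add] at h
  rw [h]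
  simp
  ring

lemma lagS_even (b m : ℕ) :
    lagS b (2 * m) = Real.Gamma (((b : ℝ) + 1) / 2 + m) / m.factorial := by
  induction m with
  | zero => simp [lagS_zero]
  | succ m ih =>
    have h := lagS_rec b (2 * m)
    rw [ih] at h
    rw [show 2 * (m + 1) = 2 * m + 2 by ring, gam_succ, Nat.factorial_succ]
    push_cast at h ⊢
    have : (2 * (m : ℝ) + 2) ≠ 0 := by positivity
    apply mul_left_cancel₀ this
    rw [h]
    field_simp
    ring

lemma lagS_odd (b m : ℕ) : lagS b (2 * m + 1) = 0 := by
  induction m with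
  | zero => simp [lagS_one]
  | succ m ih =>
    have h := lagS_rec b (2 * m + 1)
    rw [ih, mul_zero] at h
    rcases mul_eq_zero.1 h with h | h
    · have : (0 : ℝ) < ((2 * m + 1 : ℕ) : ℝ) + 2 := by positivity
      linarith
    · exact h

lemma lag_int (b k : ℕ) :
    ∫ x in Set.Ioi (0 : ℝ),
      x ^ (((b : ℝ) + 1) / 2 - 1) * Real.exp (-x / 2) * laguerre k b x
      = (2 : ℝ) ^ (((b : ℝ) + 1) / 2) * lagS b k := by
  have I : ∀ j : ℕ, ∫ x in Set.Ioi (0 : ℝ),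
      x ^ ((((b : ℝ) + 1) / 2 + j) - 1) * Real.exp (-(1 / 2 * x)) =
      (2 : ℝ) ^ (((b : ℝ) + 1) / 2) * (2 ^ j * Real.Gamma (((b : ℝ) + 1) / 2 + j)) := by
    intro j
    rw [Real.integral_rpow_mul_exp_neg_mul_Ioi (by positivity) (by norm_num)]
    rw [show (1 / (1 / 2) : ℝ) = 2 by norm_num, Real.rpow_add (by norm_num), Real.rpow_natCast]
    ring
  have J : ∀ j : ℕ, IntegrableOn (fun x : ℝ =>
      x ^ ((((b : ℝ) + 1) / 2 + j) - 1) * Real.exp (-(1 / 2 * x))) (Set.Ioi 0) := by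
    intro j
    apply Integrable.of_integral_ne_zero
    rw [I]
    have := Real.Gamma_pos_of_pos (show 0 < ((b : ℝ) + 1) / 2 + j by positivity)
    positivity
  have E : Set.EqOn
      (fun x : ℝ => x ^ (((b : ℝ) + 1) / 2 - 1) * Real.exp (-x / 2) * laguerre k b x)
      (fun x : ℝ => ∑ j ∈ Finset.range (k + 1),
        ((-1 : ℝ) ^ j * (Nat.choose (k + b) (k - j) : ℝ) / (Nat.factorial j : ℝ)) *
        (x ^ ((((b : ℝ) + 1) / 2 + j) - 1) * Real.exp (-(1 / 2 * x)))) (Set.Ioi 0) := by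
    intro x hx
    have hx : 0 < x := hx
    simp only [laguerre, Finset.mul_sum]
    refine Finset.sum_congr rfl fun j _ => ?_
    rw [show ((b : ℝ) + 1) / 2 + j - 1 = (((b : ℝ) + 1) / 2 - 1) + j by ring,
      Real.rpow_add hx, Real.rpow_natCast, show -x / 2 = -(1 / 2 * x) by ring]
    ring
  rw [setIntegral_congr_fun measurableSet_Ioi E,
    integral_finset_sum _ (fun j _ => (J j).const_mul _)]
  simp only [integral_const_mul, I, lagS, Finset.mul_sum]
  refine Finset.sum_congr rfl fun j _ => ?_
  unfold lagT
  ring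

/-- For integers `α ≥ 1`, `k ≥ 0`, the integral
`∫_0^∞ x^{α/2 − 1} e^{−x/2} L_k^{(α−1)}(x) dx` equals
`2^{α/2}·Γ((α + k)/2)/(k/2)!` when `k` is even, and `0` when `k` is odd. -/
theorem laguerre_integral (α k : ℕ) (hα : 1 ≤ α) :
    (Even k →
      ∫ x in Set.Ioi (0 : ℝ),
          x ^ ((α : ℝ) / 2 - 1) * Real.exp (-x / 2) * laguerre k (α - 1) x
        = (2 : ℝ) ^ ((α : ℝ) / 2) * Real.Gamma (((α : ℝ) + k) / 2)
            / (Nat.factorial (k / 2) : ℝ)) ∧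
    (Odd k →
      ∫ x in Set.Ioi (0 : ℝ),
          x ^ ((α : ℝ) / 2 - 1) * Real.exp (-x / 2) * laguerre k (α - 1) x = 0) := by
  obtain ⟨b, rfl⟩ : ∃ b, α = b + 1 := ⟨α - 1, by omega⟩
  have h := lag_int b k
  rw [Nat.add_sub_cancel, Nat.cast_add, Nat.cast_one, h]
  constructor
  · intro hk
    obtain ⟨m, rfl⟩ := even_iff_two_dvd.1 hk
    rw [lagS_even, Nat.mul_div_cancel_left m (by norm_num), ← mul_div_assoc]
    congr 3
    push_cast
    ring
  · rintro ⟨m, rfl⟩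
    rw [lagS_odd, mul_zero]
end

section
/- For even integers k ≥ 2 and integers α ≥ 1, define v_{k,α} = √( k! / (k + α − 1)! ) · 2^{α/2} · Γ((α + k)/2) / (k/2)!. Then for any function α : ℕ → ℕ with α(k) ≥ 1 for all k, one has v_{k,α(k)} · ( k·(α(k) + k) )^{1/4} → 2 as k → ∞ through even values. (Consequently the normalizing constant c_φ = v_{N,α}·√(a_N)/(2√2), with a_N = √(N(N+α)), converges to 1/√2 as N → ∞ through even values.) -/
open Filter

/-- `v_{k,α} = √(k!/(k + α − 1)!) · 2^{α/2} · Γ((α + k)/2) / (k/2)!`. -/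
noncomputable def v (k α : ℕ) : ℝ :=
  Real.sqrt ((Nat.factorial k : ℝ) / (Nat.factorial (k + α - 1) : ℝ)) *
    (2 : ℝ) ^ ((α : ℝ) / 2) * Real.Gamma (((α : ℝ) + k) / 2) /
    (Nat.factorial (k / 2) : ℝ)

lemma aux_mid {s t : ℝ} (hs : 0 < s) (ht : 0 < t) :
    Real.Gamma ((s + t) / 2) ^ 2 ≤ Real.Gamma s * Real.Gamma t := by
  have h := Real.Gamma_mul_add_mul_le_rpow_Gamma_mul_rpow_Gamma hs ht
    (a := 1/2) (b := 1/2) (by norm_num) (by norm_num) (by norm_num)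
  have e : (1/2 : ℝ) * s + 1/2 * t = (s + t) / 2 := by ring
  rw [e, ← Real.sqrt_eq_rpow, ← Real.sqrt_eq_rpow] at h
  have h0 : 0 < Real.Gamma ((s + t) / 2) := Real.Gamma_pos_of_pos (by positivity)
  have hG := (Real.Gamma_pos_of_pos hs).le
  have hG' := (Real.Gamma_pos_of_pos ht).le
  calc Real.Gamma ((s + t) / 2) ^ 2 ≤ (√(Real.Gamma s) * √(Real.Gamma t)) ^ 2 := by gcongr
    _ = _ := by rw [mul_pow, Real.sq_sqrt hG, Real.sq_sqrt hG']

lemma aux_lo {x : ℝ} (hx : 0 < x) :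
    1 ≤ x * (Real.Gamma x / Real.Gamma (x + 1/2)) ^ 2 := by
  have h := aux_mid hx (t := x + 1) (by positivity)
  rw [Real.Gamma_add_one hx.ne', show (x + (x + 1)) / 2 = x + 1/2 by ring] at h
  have h0 : 0 < Real.Gamma (x + 1/2) := Real.Gamma_pos_of_pos (by positivity)
  rw [div_pow, ← mul_div_assoc, le_div_iff₀ (by positivity)]
  nlinarith

lemma aux_hi {x : ℝ} (hx : 1/2 < x) :
    x * (Real.Gamma x / Real.Gamma (x + 1/2)) ^ 2 ≤ x / (x - 1/2) := by
  have hp : 0 < x - 1/2 := by linarith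
  have h := aux_mid hp (t := x + 1/2) (by linarith)
  have h2 := Real.Gamma_add_one hp.ne'
  rw [show x - 1/2 + 1 = x + 1/2 by ring] at h2
  rw [show (x - 1/2 + (x + 1/2)) / 2 = x by ring] at h
  have h0 : 0 < Real.Gamma (x + 1/2) := Real.Gamma_pos_of_pos (by linarith)
  rw [div_pow, ← mul_div_assoc, div_le_div_iff₀ (by positivity) hp]
  have : Real.Gamma x ^ 2 * (x - 1/2) ≤ Real.Gamma (x + 1/2) ^ 2 := by
    calc _ ≤ (Real.Gamma (x - 1/2) * Real.Gamma (x + 1/2)) * (x - 1/2) := by gcongr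
      _ = _ := by rw [sq]; nth_rw 2 [h2]; ring
  have hx0 : 0 < x := by linarith
  nlinarith

lemma aux_sq (m a : ℕ) : v (2 * m) (a + 1) ^ 2 =
    2 * (Real.Gamma ((2 * m + 1) / 2) / Real.Gamma ((2 * m + 1) / 2 + 1/2)) *
      (Real.Gamma ((2 * m + a + 1) / 2) / Real.Gamma ((2 * m + a + 1) / 2 + 1/2)) := by
  have d1 := Real.Gamma_mul_Gamma_add_half ((2 * m + 1) / 2 : ℝ)
  have d2 := Real.Gamma_mul_Gamma_add_half ((2 * m + a + 1) / 2 : ℝ)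
  have f1 : Real.Gamma (2 * ((2 * m + 1) / 2 : ℝ)) = (2 * m).factorial := by
    rw [← Real.Gamma_nat_eq_factorial]; congr 1; push_cast; ring
  have f2 : Real.Gamma (2 * ((2 * m + a + 1) / 2 : ℝ)) = (2 * m + a).factorial := by
    rw [← Real.Gamma_nat_eq_factorial]; congr 1; push_cast; ring
  have f3 : Real.Gamma ((2 * m + 1) / 2 + 1/2 : ℝ) = m.factorial := by
    rw [← Real.Gamma_nat_eq_factorial]; congr 1; ring
  have p1 : (2:ℝ) ^ (1 - 2 * ((2 * m + 1) / 2 : ℝ)) = ((2:ℝ) ^ (2 * m))⁻¹ := by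
    rw [← Real.rpow_natCast, ← Real.rpow_neg (by norm_num)]; congr 1; push_cast; ring
  have p2 : (2:ℝ) ^ (1 - 2 * ((2 * m + a + 1) / 2 : ℝ)) = ((2:ℝ) ^ (2 * m + a))⁻¹ := by
    rw [← Real.rpow_natCast, ← Real.rpow_neg (by norm_num)]; congr 1; push_cast; ring
  have p3 : ((2:ℝ) ^ (((a + 1 : ℕ) : ℝ) / 2)) ^ 2 = 2 ^ (a + 1) := by
    rw [← Real.rpow_natCast, ← Real.rpow_mul (by norm_num), ← Real.rpow_natCast]
    congr 1; push_cast; ring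
  have g1 : (((a + 1 : ℕ) : ℝ) + (2 * m : ℕ)) / 2 = (2 * m + a + 1) / 2 := by push_cast; ring
  rw [f1, f3, p1] at d1
  rw [f2, p2] at d2
  unfold v
  rw [g1, f3, div_pow, mul_pow, mul_pow, p3, Real.sq_sqrt (by positivity),
    show 2 * m + (a + 1) - 1 = 2 * m + a by omega, show 2 * m / 2 = m by omega]
  have hB : 0 < Real.Gamma ((2 * m + a + 1) / 2 + 1/2 : ℝ) := Real.Gamma_pos_of_pos (by positivity)
  have hA : 0 < Real.Gamma ((2 * m + a + 1) / 2 : ℝ) := Real.Gamma_pos_of_pos (by positivity)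
  have hM : (0:ℝ) < m.factorial := by positivity
  have hF : (0:ℝ) < (2 * m + a).factorial := by positivity
  have hpi : 0 < √Real.pi := Real.sqrt_pos.2 Real.pi_pos
  generalize Real.Gamma ((2 * m + a + 1) / 2 + 1/2 : ℝ) = B at *
  generalize Real.Gamma ((2 * m + a + 1) / 2 : ℝ) = A at *
  generalize Real.Gamma ((2 * m + 1) / 2 : ℝ) = C at *
  generalize (m.factorial : ℝ) = M at *
  generalize ((2 * m + a).factorial : ℝ) = F at *
  generalize ((2 * m).factorial : ℝ) = K at *
  generalize √Real.pi = P at *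
  have e1 : K = C * M * 2 ^ (2 * m) / P := by rw [d1]; field_simp
  have e2 : F = A * B * 2 ^ (2 * m + a) / P := by rw [d2]; field_simp
  rw [e1, e2]
  field_simp
  ring

lemma aux_nonneg (k a : ℕ) : 0 ≤ v k a := by
  unfold v
  have : 0 ≤ Real.Gamma (((a : ℝ) + k) / 2) := Real.Gamma_nonneg_of_nonneg (by positivity)
  positivity

lemma aux_bd (m a : ℕ) (hm : 1 ≤ m) :
    let T := (v (2 * m) (a + 1)) ^ 4 * (((2 * m : ℕ) : ℝ) * (((a + 1 : ℕ) : ℝ) + (2 * m : ℕ)))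
    16 * (((2 * m : ℕ) : ℝ) / ((2 * m : ℕ) + 1)) ≤ T ∧
      T ≤ 16 * (((2 * m : ℕ) : ℝ) / ((2 * m : ℕ) + 1))⁻¹ := by
  intro T
  have hm' : (1:ℝ) ≤ m := by exact_mod_cast hm
  have ha : (0:ℝ) ≤ a := by positivity
  have l1 := aux_lo (x := (2 * m + 1) / 2) (by positivity)
  have l2 := aux_lo (x := (2 * m + a + 1) / 2) (by positivity)
  have u1 := aux_hi (x := (2 * m + 1) / 2) (by linarith)
  have u2 := aux_hi (x := (2 * m + a + 1) / 2) (by linarith)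
  have hT : T = 16 * (((2 * m : ℕ) : ℝ) / ((2 * m : ℕ) + 1)) *
     (((2 * m + 1) / 2 : ℝ) * (Real.Gamma ((2 * m + 1) / 2) / Real.Gamma ((2 * m + 1) / 2 + 1/2)) ^ 2 *
      (((2 * m + a + 1) / 2 : ℝ) * (Real.Gamma ((2 * m + a + 1) / 2) / Real.Gamma ((2 * m + a + 1) / 2 + 1/2)) ^ 2)) := by
    simp only [T]
    rw [show v (2 * m) (a + 1) ^ 4 = (v (2 * m) (a + 1) ^ 2) ^ 2 by ring, aux_sq]
    generalize (Real.Gamma ((2 * m + 1) / 2) / Real.Gamma ((2 * m + 1) / 2 + 1/2)) = X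
    generalize (Real.Gamma ((2 * m + a + 1) / 2) / Real.Gamma ((2 * m + a + 1) / 2 + 1/2)) = Y
    push_cast
    field_simp
    ring
  rw [hT]
  have w1 : ((2 * m + 1) / 2 : ℝ) / ((2 * m + 1) / 2 - 1/2) = (2 * m + 1) / (2 * m) := by
    rw [show ((2 * m + 1) / 2 - 1/2 : ℝ) = m by ring]; field_simp
  have w2 : ((2 * m + a + 1) / 2 : ℝ) / ((2 * m + a + 1) / 2 - 1/2) ≤ (2 * m + 1) / (2 * m) := by
    rw [div_le_div_iff₀ (by linarith) (by linarith)]; nlinarith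
  rw [w1] at u1
  replace u2 := u2.trans w2
  generalize ((2 * m + 1) / 2 : ℝ) * (Real.Gamma ((2 * m + 1) / 2) / Real.Gamma ((2 * m + 1) / 2 + 1/2)) ^ 2 = X at *
  generalize ((2 * m + a + 1) / 2 : ℝ) * (Real.Gamma ((2 * m + a + 1) / 2) / Real.Gamma ((2 * m + a + 1) / 2 + 1/2)) ^ 2 = Y at *
  have hc : (0:ℝ) < 16 * (((2 * m : ℕ) : ℝ) / ((2 * m : ℕ) + 1)) := by positivity
  constructor
  · have : 1 ≤ X * Y := by nlinarith
    nlinarith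
  · have : X * Y ≤ ((2 * m + 1) / (2 * m)) * ((2 * m + 1) / (2 * m)) := by
      apply mul_le_mul u1 u2 (by linarith) (by positivity)
    refine (mul_le_mul_of_nonneg_left this hc.le).trans (le_of_eq ?_)
    push_cast
    field_simp

/-- For any `α : ℕ → ℕ` with `α(k) ≥ 1` for all `k`,
`v_{k,α(k)} · (k·(α(k) + k))^{1/4} → 2` as `k → ∞` through even values. -/
theorem v_limit (α : ℕ → ℕ) (hα : ∀ k, 1 ≤ α k) :
    Tendsto (fun k : ℕ => v k (α k) * ((k : ℝ) * ((α k : ℝ) + k)) ^ ((1 : ℝ) / 4))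
      (atTop ⊓ Filter.principal {k : ℕ | Even k}) (nhds 2) := by
  have hq : Tendsto (fun k : ℕ => (k : ℝ) / (k + 1)) (atTop ⊓ Filter.principal {k : ℕ | Even k})
      (nhds 1) := (tendsto_natCast_div_add_atTop (1:ℝ)).mono_left inf_le_left
  have hlo := hq.const_mul 16
  have hhi := (hq.inv₀ one_ne_zero).const_mul 16
  rw [inv_one] at hhi
  have hev : ∀ᶠ k : ℕ in atTop ⊓ Filter.principal {k : ℕ | Even k}, 2 ≤ k ∧ Even k := by
    rw [eventually_inf_principal]
    filter_upwards [eventually_ge_atTop 2] with k hk he using ⟨hk, he⟩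
  have hbd : ∀ᶠ k : ℕ in atTop ⊓ Filter.principal {k : ℕ | Even k},
      16 * ((k : ℝ) / (k + 1)) ≤ v k (α k) ^ 4 * ((k : ℝ) * ((α k : ℝ) + k)) ∧
      v k (α k) ^ 4 * ((k : ℝ) * ((α k : ℝ) + k)) ≤ 16 * ((k : ℝ) / (k + 1))⁻¹ := by
    filter_upwards [hev] with k hk
    obtain ⟨hk, he⟩ := hk
    obtain ⟨m, rfl⟩ := even_iff_exists_two_mul.1 he
    have h1 := hα (2 * m)
    obtain ⟨a, h⟩ : ∃ a, α (2 * m) = a + 1 := ⟨α (2 * m) - 1, by omega⟩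
    rw [h]
    exact aux_bd m a (by omega)
  have hT := tendsto_of_tendsto_of_tendsto_of_le_of_le' hlo hhi
    (hbd.mono fun _ h => h.1) (hbd.mono fun _ h => h.2)
  have hR := hT.rpow_const (p := (1:ℝ)/4) (Or.inr (by norm_num))
  have e : ((16:ℝ) * 1) ^ ((1:ℝ)/4) = 2 := by
    rw [show (16:ℝ) * 1 = 2 ^ (4:ℝ) by norm_num, ← Real.rpow_mul (by norm_num)]
    norm_num
  rw [e] at hR
  refine hR.congr fun k => ?_
  rw [Real.mul_rpow (pow_nonneg (aux_nonneg _ _) 4) (by positivity), ← Real.rpow_natCast,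
    ← Real.rpow_mul (aux_nonneg _ _)]
  norm_num
end

section
/- As the real number m → ∞, Γ(m/2) · 2^{m/2} · m^{1/4} / √(Γ(m)) → √2 · (2π)^{1/4} (= 2^{3/4} π^{1/4}). Equivalently, Γ(m/2)/√(Γ(m)) ~ 2^{−m/2} · m^{−1/4} · (2π)^{1/4} · √2. -/
open Filter

lemma gamma_mid {s : ℝ} (hs : 0 < s) :
    Real.Gamma (s + 1/2) ^ 2 ≤ s * Real.Gamma s ^ 2 := by
  have h := Real.Gamma_mul_add_mul_le_rpow_Gamma_mul_rpow_Gamma hs (show 0 < s + 1 by linarith)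
    (show (0:ℝ) < 1/2 by norm_num) (show (0:ℝ) < 1/2 by norm_num) (by norm_num)
  have e : 1/2 * s + 1/2 * (s+1) = s + 1/2 := by ring
  have g0 := Real.Gamma_pos_of_pos hs
  have g1 := Real.Gamma_pos_of_pos (show 0 < s + 1/2 by linarith)
  rw [e, Real.Gamma_add_one hs.ne', ← Real.mul_rpow g0.le (by positivity), ← Real.sqrt_eq_rpow] at h
  calc _ ≤ (Real.sqrt (Real.Gamma s * (s * Real.Gamma s))) ^ 2 := by gcongr
    _ = _ := by rw [Real.sq_sqrt (by positivity)]; ring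

lemma gamma_fourth {m : ℝ} (hm : 0 < m) :
    (Real.Gamma (m / 2) * (2 : ℝ) ^ (m / 2) * m ^ ((1 : ℝ) / 4)
          / Real.sqrt (Real.Gamma m)) ^ 4 =
    4 * Real.pi * m * (Real.Gamma (m/2) ^ 2 / Real.Gamma (m/2 + 1/2) ^ 2) := by
  have h := Real.Gamma_mul_Gamma_add_half (m/2)
  have g0 := Real.Gamma_pos_of_pos (show 0 < m/2 by linarith)
  have g1 := Real.Gamma_pos_of_pos (show 0 < m/2 + 1/2 by linarith)
  have g2 := Real.Gamma_pos_of_pos hm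
  have e : 2 * (m/2) = m := by ring
  rw [e, Real.rpow_sub two_pos, Real.rpow_one] at h
  have p : (2:ℝ) ^ m = ((2:ℝ) ^ (m/2)) ^ 2 := by
    rw [← Real.rpow_natCast, ← Real.rpow_mul two_pos.le]; congr 1; push_cast; ring
  have q : (m ^ ((1:ℝ)/4)) ^ 4 = m := by
    rw [← Real.rpow_natCast, ← Real.rpow_mul hm.le]; norm_num
  have r : Real.sqrt (Real.Gamma m) ^ 4 = Real.Gamma m ^ 2 := by
    rw [show 4 = 2 * 2 from rfl, pow_mul, Real.sq_sqrt g2.le]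
  have t := Real.sq_sqrt Real.pi_pos.le
  have p0 : (0:ℝ) < 2 ^ (m/2) := by positivity
  rw [p] at h
  rw [div_pow, mul_pow, mul_pow, q, r]
  generalize (2:ℝ) ^ (m/2) = x at *
  have h2 : Real.Gamma (m/2) * Real.Gamma (m/2+1/2) * x^2 = Real.Gamma m * 2 * √Real.pi := by
    rw [h]; field_simp
  have h3 : (Real.Gamma (m/2) * Real.Gamma (m/2+1/2) * x^2)^2 = Real.Gamma m ^2 * 4 * Real.pi := by
    rw [h2, mul_pow, t]; ring
  rw [mul_div_assoc', div_eq_div_iff (by positivity) (by positivity)]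
  linear_combination (m * Real.Gamma (m/2)^2) * h3

/-- As the real `m → ∞`, `Γ(m/2)·2^{m/2}·m^{1/4}/√(Γ(m)) → √2·(2π)^{1/4}`. -/
theorem gamma_ratio_limit :
    Tendsto (fun m : ℝ =>
        Real.Gamma (m / 2) * (2 : ℝ) ^ (m / 2) * m ^ ((1 : ℝ) / 4)
          / Real.sqrt (Real.Gamma m))
      atTop (nhds (Real.sqrt 2 * (2 * Real.pi) ^ ((1 : ℝ) / 4))) := by
  have key : Tendsto (fun m : ℝ => (Real.Gamma (m / 2) * (2 : ℝ) ^ (m / 2) * m ^ ((1 : ℝ) / 4)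
          / Real.sqrt (Real.Gamma m)) ^ 4) atTop (nhds (8 * Real.pi)) := by
    have up : Tendsto (fun m : ℝ => 8 * Real.pi * (1 + m⁻¹)) atTop (nhds (8 * Real.pi)) := by
      simpa using (tendsto_inv_atTop_zero.const_add (1:ℝ)).const_mul (8 * Real.pi)
    refine tendsto_of_tendsto_of_tendsto_of_le_of_le' tendsto_const_nhds up ?_ ?_
    · filter_upwards [eventually_gt_atTop 0] with m hm
      rw [gamma_fourth hm]
      have g1 := Real.Gamma_pos_of_pos (show 0 < m/2 + 1/2 by linarith)
      have h := gamma_mid (show 0 < m/2 by linarith)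
      rw [mul_div_assoc', le_div_iff₀ (by positivity)]
      nlinarith [mul_le_mul_of_nonneg_left h Real.pi_pos.le]
    · filter_upwards [eventually_gt_atTop 0] with m hm
      rw [gamma_fourth hm]
      have g1 := Real.Gamma_pos_of_pos (show 0 < m/2 + 1/2 by linarith)
      have h := gamma_mid (show 0 < m/2 + 1/2 by linarith)
      rw [show m/2+1/2+1/2 = m/2+1 by ring, Real.Gamma_add_one (by positivity)] at h
      rw [mul_div_assoc', div_le_iff₀ (by positivity)]
      have h' := mul_le_mul_of_nonneg_left h (show 0 ≤ 16 * Real.pi * m⁻¹ by positivity)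
      calc _ = 16 * Real.pi * m⁻¹ * (m / 2 * Real.Gamma (m / 2)) ^ 2 := by field_simp; ring
        _ ≤ _ := h'
        _ = _ := by field_simp; ring
  have k2 := key.rpow_const (p := (1:ℝ)/4) (Or.inr (by norm_num))
  have e : (8 * Real.pi) ^ ((1:ℝ)/4) = Real.sqrt 2 * (2 * Real.pi) ^ ((1 : ℝ) / 4) := by
    rw [show 8 * Real.pi = (2:ℝ)^(2:ℝ) * (2 * Real.pi) by norm_num; ring,
      Real.mul_rpow (by positivity) (by positivity), ← Real.rpow_mul two_pos.le, Real.sqrt_eq_rpow]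
    norm_num
  rw [e] at k2
  refine k2.congr' ?_
  filter_upwards [eventually_gt_atTop 0] with m hm
  have g0 := Real.Gamma_pos_of_pos (show 0 < m/2 by linarith)
  rw [← Real.rpow_natCast, ← Real.rpow_mul (by positivity)]
  norm_num
end
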